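/- arXiv:1407.2380 — 2 statements merged into one kernel-verified Lean document; each statement's English description precedes it below -/
import Mathlib

section
/- Let d ≥ 1 and let q be a prime. There exists a constant c(q,d) > 0 such that for almost all d-tuples of coefficient sequences (a_{j,k})_{k≥1} ∈ Z_q^{ℕ}, 1 ≤ j ≤ d, with respect to the product probability measure under which all coefficients a_{j,k} are independent and uniformly distributed on Z_q (this measure corresponds to the d-fold Haar measure on (Z_q((x^{−1})))^d restricted to fractional parts), the digital Kronecker sequence S(f) generated by f = (f_1,…,f_d) with f_j = Σ_{k≥1} a_{j,k} x^{−k} has star discrepancy satisfying D_N*(S(f)) ≥ c(q,d) · (log N)^d (log log N) / N for infinitely many N ∈ ℕ. -/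
open MeasureTheory Real

instance (n : ℕ) : MeasurableSpace (ZMod n) := ⊤

/-- The star discrepancy of the first `N` points of a sequence `z` in `[0,1)^ι`. -/
noncomputable def starDisc {ι : Type*} [Fintype ι] (z : ℕ → ι → ℝ) (N : ℕ) : ℝ :=
  sSup { r : ℝ | ∃ v : ι → ℝ,
    (∀ i, 0 < v i ∧ v i ≤ 1) ∧
    r = |(Nat.card {n : ℕ // n < N ∧ ∀ i, 0 ≤ z n i ∧ z n i < v i} : ℝ) / N
          - ∏ i, v i| }

/-- The digital Kronecker sequence generated by `f = (f_1, …, f_d)` with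
`f_j = ∑_{k≥1} a j (k-1) · x^{-k}` (so `a j k` is the coefficient of `x^{-(k+1)}`):
the coefficient of `x^{-(m+1)}` of the fractional part of `n(x)·f_j(x)` is
`∑_i n_i · a j (m+i)`, and the `j`-th coordinate of the `n`-th point is this
Laurent series evaluated at `x = q`. -/
noncomputable def digitalKronecker {q : ℕ} (d : ℕ) (a : Fin d → ℕ → ZMod q)
    (n : ℕ) : Fin d → ℝ :=
  fun j => ∑' m : ℕ,
    ((∑ i ∈ Finset.range (Nat.digits q n).length,
        ((Nat.digits q n).getD i 0 : ZMod q) * a j (m + i)).val : ℝ) / (q : ℝ) ^ (m + 1)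


section LinearForm

open Polynomial

variable {R : Type*} [CommRing R]

/-- The residue pairing of a polynomial with a coefficient sequence: `digitPairing a p` is the
coefficient of `x⁻¹` of the product of `p` with the Laurent series `∑ k, a k * x ^ (-(k + 1))`. -/
noncomputable def digitPairing (a : ℕ → R) : R[X] →ₗ[R] R :=
  Polynomial.lsum fun l => LinearMap.mulRight R (a l)

theorem digitPairing_eq_sum_range (a : ℕ → R) {p : R[X]} {n : ℕ} (h : p.natDegree < n) :
    digitPairing a p = ∑ l ∈ Finset.range n, p.coeff l * a l := by
  rw [digitPairing, Polynomial.lsum_apply, Polynomial.sum_over_range' _ _ n h]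
  · simp
  · simp

theorem digitPairing_X_pow (a : ℕ → R) (i : ℕ) : digitPairing a (X ^ i) = a i := by
  rw [digitPairing_eq_sum_range a (n := i + 1) (by
    exact (natDegree_X_pow_le i).trans_lt (Nat.lt_succ_self i))]
  simp [coeff_X_pow]

theorem digitPairing_X_pow_mul (a : ℕ → R) (i : ℕ) {p : R[X]} {n : ℕ} (h : p.natDegree < n) :
    digitPairing a (X ^ i * p) = ∑ l ∈ Finset.range n, p.coeff l * a (i + l) := by
  conv_lhs => rw [p.as_sum_range' n h, Finset.mul_sum, map_sum]
  refine Finset.sum_congr rfl fun l _ => ?_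
  rw [← C_mul_X_pow_eq_monomial, mul_left_comm, ← pow_add, C_mul', map_smul, digitPairing_X_pow,
    smul_eq_mul]

/-- The linear form in the coefficients of `d` Laurent series attached to a vector of
polynomials. -/
noncomputable def vecPairing {ι : Type*} [Fintype ι] (a : ι → ℕ → R) : (ι → R[X]) →ₗ[R] R :=
  ∑ j, (digitPairing (a j)).comp (LinearMap.proj j)

theorem vecPairing_apply {ι : Type*} [Fintype ι] (a : ι → ℕ → R) (h : ι → R[X]) :
    vecPairing a h = ∑ j, digitPairing (a j) (h j) := by
  simp [vecPairing]

/-- The first `r` digits of the fractional part of the linear form with coefficient vector `h`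
vanish at `a`. -/
def DigitsVanish {ι : Type*} [Fintype ι] (a : ι → ℕ → R) (h : ι → R[X]) (r : ℕ) : Prop :=
  ∀ i < r, vecPairing a (fun j => X ^ i * h j) = 0

theorem DigitsVanish.mul {ι : Type*} [Fintype ι] {a : ι → ℕ → R} {h : ι → R[X]} {r : ℕ}
    (H : DigitsVanish a h r) {c : R[X]} (hc : c.degree < r) :
    vecPairing a (fun j => c * h j) = 0 := by
  rcases eq_or_ne c 0 with rfl | h0
  · simp [vecPairing_apply]
  have hn : c.natDegree < r := (natDegree_lt_iff_degree_lt h0).2 hc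
  have : (fun j => c * h j) = ∑ i ∈ Finset.range r, c.coeff i • (fun j => X ^ i * h j) := by
    funext j
    conv_lhs => rw [c.as_sum_range_C_mul_X_pow' hn]
    simp [Finset.sum_mul, smul_eq_C_mul, mul_assoc]
  rw [this, map_sum]
  refine Finset.sum_eq_zero fun i hi => ?_
  rw [map_smul, H i (Finset.mem_range.1 hi), smul_zero]

end LinearForm

section Discrepancy

theorem abs_le_starDisc {ι : Type*} [Fintype ι] (z : ℕ → ι → ℝ) {N : ℕ} (v : ι → ℝ)
    (hv : ∀ i, 0 < v i ∧ v i ≤ 1) :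
    |(Nat.card {n : ℕ // n < N ∧ ∀ i, 0 ≤ z n i ∧ z n i < v i} : ℝ) / N - ∏ i, v i|
      ≤ starDisc z N := by
  refine le_csSup ⟨1, ?_⟩ ⟨v, hv, rfl⟩
  rintro r ⟨w, hw, rfl⟩
  have h1 : (Nat.card {n : ℕ // n < N ∧ ∀ i, 0 ≤ z n i ∧ z n i < w i} : ℝ) / N ≤ 1 := by
    refine div_le_one_of_le₀ ?_ (Nat.cast_nonneg _)
    have : Nat.card {n : ℕ // n < N ∧ ∀ i, 0 ≤ z n i ∧ z n i < w i} ≤ Nat.card (Set.Iio N) :=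
      Nat.card_mono (Set.finite_Iio N) fun n hn => hn.1
    rw [Nat.card_eq_card_toFinset] at this
    simpa using this
  have h2 : ∏ i, w i ≤ 1 := Finset.prod_le_one (fun i _ => (hw i).1.le) fun i _ => (hw i).2
  have h3 : 0 ≤ ∏ i, w i := Finset.prod_nonneg fun i _ => (hw i).1.le
  have h4 : 0 ≤ (Nat.card {n : ℕ // n < N ∧ ∀ i, 0 ≤ z n i ∧ z n i < w i} : ℝ) / N := by
    positivity
  rw [abs_le]
  constructor <;> linarith

/-- A box that contains no point among the first `N` forces a large star discrepancy. -/
theorem prod_le_four_mul_starDisc {ι : Type*} [Fintype ι] [DecidableEq ι] (z : ℕ → ι → ℝ) {N : ℕ}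
    (w : ι → ℝ) (j₀ : ι) (hw : ∀ j, 0 < w j ∧ w j ≤ 1) (hw₀ : 2 * w j₀ ≤ 1)
    (hz : ∀ n < N, (∀ j, j ≠ j₀ → z n j < w j) → z n j₀ < 2 * w j₀ → z n j₀ < 3 / 2 * w j₀) :
    ∏ j, w j ≤ 4 * starDisc z N := by
  have hprod (t : ℝ) : ∏ j, Function.update w j₀ (t * w j₀) j = t * ∏ j, w j := by
    rw [Finset.prod_update_of_mem (Finset.mem_univ _), mul_assoc,
      Finset.sdiff_singleton_eq_erase, Finset.mul_prod_erase _ _ (Finset.mem_univ _)]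
  have hbox (t : ℝ) (h0 : 0 < t) (h2 : t ≤ 2) (j : ι) :
      0 < Function.update w j₀ (t * w j₀) j ∧ Function.update w j₀ (t * w j₀) j ≤ 1 := by
    have := hw j₀
    rcases eq_or_ne j j₀ with rfl | hj
    · simp only [Function.update_self]
      constructor <;> nlinarith
    · simpa [hj] using hw j
  have hA := abs_le_starDisc z (N := N) _ (hbox 2 two_pos le_rfl)
  have hB := abs_le_starDisc z (N := N) _ (hbox (3 / 2) (by norm_num) (by norm_num))
  have hcard : Nat.card {n : ℕ // n < N ∧ ∀ i, 0 ≤ z n i ∧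
        z n i < Function.update w j₀ (2 * w j₀) i}
      = Nat.card {n : ℕ // n < N ∧ ∀ i, 0 ≤ z n i ∧
        z n i < Function.update w j₀ (3 / 2 * w j₀) i} := by
    congr 2
    funext n
    rw [eq_iff_iff]
    refine and_congr_right fun hn => ⟨fun H i => ⟨(H i).1, ?_⟩, fun H i => ⟨(H i).1, ?_⟩⟩
    · rcases eq_or_ne i j₀ with rfl | hi
      · have h1 : z n i < 2 * w i := by simpa using (H i).2
        simpa using hz n hn (fun j hj => by simpa [hj] using (H j).2) h1
      · simpa [hi] using (H i).2
    · rcases eq_or_ne i j₀ with rfl | hi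
      · have h1 : z n i < 3 / 2 * w i := by simpa using (H i).2
        have := hw i
        simp only [Function.update_self]
        linarith
      · simpa [hi] using (H i).2
  rw [hcard, hprod] at hA
  rw [hprod] at hB
  rw [abs_le] at hA hB
  linarith [hA.1, hB.2]

variable {q : ℕ}

theorem summable_digits [NeZero q] (hq : 1 < q) (y : ℕ → ZMod q) :
    Summable fun m : ℕ => ((y m).val : ℝ) / (q : ℝ) ^ (m + 1) := by
  have hq' : (1 : ℝ) < q := by exact_mod_cast hq
  refine Summable.of_nonneg_of_le (fun m => by positivity) (fun m => ?_)
    (summable_geometric_of_lt_one (r := (q : ℝ)⁻¹) (by positivity) (inv_lt_one_of_one_lt₀ hq'))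
  have : ((y m).val : ℝ) ≤ q := by exact_mod_cast (ZMod.val_lt (y m)).le
  rw [inv_pow, div_le_iff₀ (by positivity), pow_succ]
  field_simp
  exact this

theorem digit_lt_of_tsum_lt [NeZero q] (hq : 1 < q) (y : ℕ → ZMod q) {t : ℝ} {l : ℕ}
    (h : ∑' m : ℕ, ((y m).val : ℝ) / (q : ℝ) ^ (m + 1) < t / (q : ℝ) ^ (l + 1)) :
    ((y l).val : ℝ) < t := by
  have hq' : (0 : ℝ) < q := by exact_mod_cast zero_lt_one.trans hq
  have h1 := ((summable_digits hq y).le_tsum l fun _ _ => by positivity).trans_lt h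
  exact (div_lt_div_iff_of_pos_right (by positivity)).1 h1

theorem digit_eq_zero_of_tsum_lt [NeZero q] (hq : 1 < q) (y : ℕ → ZMod q) {k l : ℕ} (hl : l ≤ k)
    (h : ∑' m : ℕ, ((y m).val : ℝ) / (q : ℝ) ^ (m + 1) < 1 / (q : ℝ) ^ (k + 1)) : y l = 0 := by
  have hq' : (1 : ℝ) ≤ q := by exact_mod_cast hq.le
  have h1 : ((y l).val : ℝ) < 1 := digit_lt_of_tsum_lt hq y (h.trans_le
    (one_div_le_one_div_of_le (by positivity) (pow_le_pow_right₀ hq' (by lia))))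
  rw [← ZMod.val_eq_zero]
  exact Nat.lt_one_iff.1 (by exact_mod_cast h1)

theorem tsum_digits_le [NeZero q] (hq : 1 < q) (y : ℕ → ZMod q) {k : ℕ}
    (h : ∀ l < k, y l = 0) :
    ∑' m : ℕ, ((y m).val : ℝ) / (q : ℝ) ^ (m + 1) ≤ 1 / (q : ℝ) ^ k := by
  have hq' : (1 : ℝ) < q := by exact_mod_cast hq
  have hq0 : (0 : ℝ) < q := zero_lt_one.trans hq'
  have hr : (q : ℝ)⁻¹ < 1 := inv_lt_one_of_one_lt₀ hq'
  have hs := summable_digits hq y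
  rw [← hs.sum_add_tsum_nat_add k, Finset.sum_eq_zero fun l hl => by
    simp [h l (Finset.mem_range.1 hl)], zero_add]
  have hg := summable_geometric_of_lt_one (r := (q : ℝ)⁻¹) (by positivity) hr
  calc ∑' i : ℕ, ((y (i + k)).val : ℝ) / (q : ℝ) ^ (i + k + 1)
      ≤ ∑' i : ℕ, ((q - 1 : ℝ) / q ^ (k + 1)) * ((q : ℝ)⁻¹) ^ i := by
        refine Summable.tsum_le_tsum (fun i => ?_) ((summable_nat_add_iff k).2 hs)
          (hg.mul_left _)
        have : ((y (i + k)).val : ℝ) ≤ q - 1 := by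
          have := ZMod.val_lt (y (i + k))
          have h2 : ((y (i + k)).val : ℝ) + 1 ≤ q := by exact_mod_cast this
          linarith
        rw [inv_pow, ← div_eq_mul_inv, div_div, ← pow_add, show k + 1 + i = i + k + 1 by ring]
        gcongr
    _ = 1 / (q : ℝ) ^ k := by
        rw [tsum_mul_left, tsum_geometric_of_lt_one (by positivity) hr]
        have : (q : ℝ) - 1 ≠ 0 := by linarith
        rw [pow_succ]
        field_simp

/-- The digits of a number in `[3/2 * q ^ (-k-1), 2 * q ^ (-k-1))` start with `k` zeros and a
one. -/
theorem digits_of_tsum_lt [NeZero q] (hq : 1 < q) (y : ℕ → ZMod q) {k : ℕ}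
    (h₁ : 3 / 2 * (1 / (q : ℝ) ^ (k + 1)) ≤ ∑' m : ℕ, ((y m).val : ℝ) / (q : ℝ) ^ (m + 1))
    (h₂ : ∑' m : ℕ, ((y m).val : ℝ) / (q : ℝ) ^ (m + 1) < 2 * (1 / (q : ℝ) ^ (k + 1))) :
    (∀ l < k, y l = 0) ∧ y k = 1 := by
  have hq' : (2 : ℝ) ≤ q := by exact_mod_cast hq
  have hz : ∀ l < k, y l = 0 := by
    intro l hl
    obtain ⟨k, rfl⟩ : ∃ k', k = k' + 1 := ⟨k - 1, by lia⟩
    refine digit_eq_zero_of_tsum_lt hq y (k := k) (by lia) (h₂.trans_le ?_)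
    rw [pow_succ (q : ℝ) (k + 1), mul_one_div, div_le_div_iff₀ (by positivity) (by positivity)]
    nlinarith [pow_pos (show (0 : ℝ) < q by linarith) (k + 1)]
  refine ⟨hz, ?_⟩
  have h3 : (y k).val ≠ 0 := by
    intro h0
    rw [ZMod.val_eq_zero] at h0
    have := tsum_digits_le hq y (k := k + 1) fun l hl => by
      rcases Nat.lt_succ_iff_lt_or_eq.1 hl with h | rfl
      · exact hz l h
      · exact h0
    have hp : 0 < 1 / (q : ℝ) ^ (k + 1) := by positivity
    linarith
  have h4 : ((y k).val : ℝ) < 2 := digit_lt_of_tsum_lt hq y (by rwa [mul_one_div] at h₂)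
  have h5 : (y k).val < 2 := by exact_mod_cast h4
  have h6 : (y k).val = 1 := by lia
  have h7 := ZMod.natCast_zmod_val (y k)
  rw [h6] at h7
  simpa using h7.symm

open Polynomial

theorem digitalKronecker_eq_digitPairing [NeZero q] (d : ℕ) (a : Fin d → ℕ → ZMod q) {n r : ℕ}
    (hr : (Nat.digits q n).length ≤ r) :
    ∃ P : (ZMod q)[X], P.degree < r ∧ ∀ j, digitalKronecker d a n j
      = ∑' m : ℕ, ((digitPairing (a j) (X ^ m * P)).val : ℝ) / (q : ℝ) ^ (m + 1) := by
  set D := Nat.digits q n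
  refine ⟨∑ i ∈ Finset.range D.length, C (D.getD i 0 : ZMod q) * X ^ i, ?_, fun j => ?_⟩
  · refine (Polynomial.degree_sum_le _ _).trans_lt ?_
    refine (Finset.sup_lt_iff (WithBot.bot_lt_coe r)).2 fun i hi => ?_
    refine (degree_C_mul_X_pow_le _ _).trans_lt ?_
    exact (Nat.cast_lt (α := WithBot ℕ)).2 ((Finset.mem_range.1 hi).trans_le hr)
  · unfold digitalKronecker
    refine tsum_congr fun m => ?_
    congr 3
    rw [Finset.mul_sum, map_sum]
    refine Finset.sum_congr rfl fun i _ => ?_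
    rw [mul_left_comm, ← pow_add, C_mul', map_smul, digitPairing_X_pow, smul_eq_mul]

/-- A linear form with monic coefficients and with many vanishing digits at `a` forces a large
discrepancy of the digital Kronecker sequence generated by `a`. -/
theorem inv_pow_le_starDisc [NeZero q] (hq : 1 < q) {d : ℕ} (j₀ : Fin d)
    (a : Fin d → ℕ → ZMod q) (h : Fin d → (ZMod q)[X]) (hh : ∀ j, (h j).Monic) {r : ℕ}
    (H : DigitsVanish a h r) :
    1 / (q : ℝ) ^ (∑ j, ((h j).natDegree + 1))
      ≤ 4 * starDisc (digitalKronecker d a) (q ^ r) := by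
  have : Fact (1 < q) := ⟨hq⟩
  have hq' : (2 : ℝ) ≤ q := by exact_mod_cast hq
  have hpow : ∀ k : ℕ, (2 : ℝ) ≤ (q : ℝ) ^ (k + 1) := fun k =>
    hq'.trans (le_self_pow₀ (by linarith) (Nat.succ_ne_zero k))
  have hprod : 1 / (q : ℝ) ^ (∑ j, ((h j).natDegree + 1))
      = ∏ j, 1 / (q : ℝ) ^ ((h j).natDegree + 1) := by
    rw [Finset.prod_div_distrib, Finset.prod_const_one, Finset.prod_pow_eq_pow_sum]
  rw [hprod]
  refine prod_le_four_mul_starDisc _ _ j₀ (fun j => ⟨by positivity, ?_⟩) ?_ ?_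
  · rw [div_le_one (by positivity)]
    linarith [hpow (h j).natDegree]
  · rw [mul_one_div, div_le_one (by positivity)]
    exact hpow _
  · intro n hn hj h2
    by_contra h1
    push Not at h1
    obtain ⟨P, hP, hK⟩ := digitalKronecker_eq_digitPairing d a (n := n) (r := r)
      ((Nat.digits_length_le_iff hq n).2 hn)
    rw [hK] at h1 h2
    obtain ⟨hz, h1⟩ := digits_of_tsum_lt hq _ h1 h2
    have key := H.mul hP
    rw [vecPairing_apply] at key
    have hterm : ∀ j, digitPairing (a j) (P * h j)
        = ∑ l ∈ Finset.range ((h j).natDegree + 1),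
          (h j).coeff l * digitPairing (a j) (X ^ l * P) := by
      intro j
      conv_lhs => rw [(h j).as_sum_range_C_mul_X_pow, Finset.mul_sum, map_sum]
      refine Finset.sum_congr rfl fun l _ => ?_
      rw [mul_left_comm, C_mul', map_smul, smul_eq_mul, mul_comm P]
    rw [Finset.sum_eq_single j₀, hterm, Finset.sum_range_succ, Finset.sum_eq_zero, h1] at key
    · rw [zero_add, mul_one] at key
      exact one_ne_zero ((hh j₀).symm.trans key)
    · intro l hl
      rw [hz l (Finset.mem_range.1 hl), mul_zero]
    · intro j _ hne
      rw [hterm]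
      refine Finset.sum_eq_zero fun l hl => ?_
      have := hj j hne
      rw [hK] at this
      rw [digit_eq_zero_of_tsum_lt hq _ (Nat.lt_succ_iff.1 (Finset.mem_range.1 hl)) this, mul_zero]
    · simp

end Discrepancy

section Growth

open Polynomial

/-- The number of additional vanishing digits required from a linear form whose coefficients
have degree about `2 ^ k`. -/
def extraDigits (q d k : ℕ) : ℕ := Nat.clog q (2 ^ (k * d) * k)

theorem le_pow_extraDigits {q : ℕ} (hq : 1 < q) (d k : ℕ) :
    2 ^ (k * d) * k ≤ q ^ extraDigits q d k :=
  Nat.le_pow_clog hq _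

theorem extraDigits_le {q : ℕ} (hq : 1 < q) (d k : ℕ) :
    extraDigits q d k ≤ (d + 1) * 2 ^ k := by
  have h1 : extraDigits q d k ≤ k * d + k := by
    refine (Nat.clog_anti_left one_lt_two hq).trans (Nat.clog_le_of_le_pow ?_)
    rw [pow_add]
    exact Nat.mul_le_mul_left _ Nat.lt_two_pow_self.le
  have h2 : k ≤ 2 ^ k := Nat.lt_two_pow_self.le
  nlinarith

theorem inv_le_two_pow_mul_inv_pow_extraDigits {q : ℕ} (hq : 1 < q) {d k : ℕ} (hd : 1 ≤ d)
    (hk : 1 ≤ k) :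
    ((q : ℝ) * k)⁻¹ ≤ 2 ^ (k * d) * ((q : ℝ)⁻¹) ^ extraDigits q d k := by
  have hx : 1 < 2 ^ (k * d) * k := by
    have : 1 < 2 ^ (k * d) := Nat.one_lt_two_pow (by positivity)
    nlinarith
  have hlt := Nat.pow_pred_clog_lt_self hq hx
  have hpos : 0 < Nat.clog q (2 ^ (k * d) * k) := Nat.clog_pos hq hx
  have h1 : q ^ extraDigits q d k ≤ q * (2 ^ (k * d) * k) := by
    rw [extraDigits, ← Nat.succ_pred_eq_of_pos hpos, pow_succ, mul_comm]
    exact Nat.mul_le_mul_left _ hlt.le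
  have h2 : (q : ℝ) ^ extraDigits q d k ≤ q * (2 ^ (k * d) * k) := by exact_mod_cast h1
  have hq0 : (0 : ℝ) < q := by exact_mod_cast zero_lt_one.trans hq
  have hk0 : (0 : ℝ) < k := by exact_mod_cast hk
  rw [inv_pow, ← div_eq_mul_inv, inv_eq_one_div, div_le_div_iff₀ (by positivity) (by positivity)]
  linarith

theorem exists_lt_sum_Ico_inv (T : ℝ) (k₀ : ℕ) :
    ∃ K, T < ∑ k ∈ Finset.Ico k₀ K, ((k : ℝ))⁻¹ := by
  have h := Real.tendsto_sum_range_one_div_nat_succ_atTop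
  obtain ⟨n, hn⟩ := (h.eventually (Filter.eventually_gt_atTop
    (T + ∑ k ∈ Finset.range k₀, ((k : ℝ))⁻¹))).exists
  refine ⟨max k₀ (n + 1), ?_⟩
  have h1 : ∑ i ∈ Finset.range n, 1 / ((i : ℝ) + 1) ≤
      ∑ k ∈ Finset.range (max k₀ (n + 1)), ((k : ℝ))⁻¹ := by
    calc ∑ i ∈ Finset.range n, 1 / ((i : ℝ) + 1)
        = ∑ k ∈ Finset.range (n + 1), ((k : ℝ))⁻¹ := by
          rw [Finset.sum_range_succ']
          simp
      _ ≤ _ := Finset.sum_le_sum_of_subset_of_nonneg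
          (Finset.range_subset_range.2 (le_max_right _ _)) fun i _ _ => by positivity
  have h2 := Finset.sum_range_add_sum_Ico (fun k : ℕ => ((k : ℝ))⁻¹) (le_max_left k₀ (n + 1))
  linarith

/-- The set of coefficient sequences for which some linear form with monic coefficients of degree
less than `2 ^ (k + 1)` has exceptionally many vanishing digits. -/
def exceptionalSet (q d k : ℕ) : Set (Fin d → ℕ → ZMod q) :=
  {a | ∃ h : Fin d → (ZMod q)[X], (∀ j, (h j).Monic ∧ (h j).natDegree < 2 ^ (k + 1)) ∧
    DigitsVanish a h (∑ j, (h j).natDegree + extraDigits q d k)}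

theorem exists_le_starDisc_of_mem_exceptionalSet {q : ℕ} (hq : 1 < q) {d : ℕ} (hd : 1 ≤ d) :
    ∃ c : ℝ, 0 < c ∧ ∀ a : Fin d → ℕ → ZMod q, ∀ k, 1 ≤ k → a ∈ exceptionalSet q d k →
      ∃ N : ℕ, k ≤ N ∧ c * Real.log N ^ d * Real.log (Real.log N) / N
        ≤ starDisc (digitalKronecker d a) N := by
  have : NeZero q := ⟨by lia⟩
  have hq2 : (2 : ℝ) ≤ q := by exact_mod_cast hq
  have hd1 : (1 : ℝ) ≤ d := by exact_mod_cast hd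
  have hlq : 1 / 2 ≤ Real.log q :=
    (by linarith [Real.log_two_gt_d9] : 1 / 2 ≤ Real.log 2).trans
      (Real.log_le_log two_pos hq2)
  set A : ℝ := 4 * d * Real.log q with hA
  have hA1 : 1 ≤ A := by nlinarith
  have hlA : 0 ≤ Real.log A := Real.log_nonneg hA1
  set B : ℝ := 4 * q ^ d * (A ^ d * (Real.log A + 1)) with hB
  have hB0 : 0 < B := by positivity
  refine ⟨B⁻¹, inv_pos.2 hB0, fun a k hk hak => ?_⟩
  obtain ⟨h, hh, H⟩ := hak
  set M := ∑ j, (h j).natDegree with hM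
  set ρ := extraDigits q d k with hρ
  have hk1 : (1 : ℝ) ≤ k := by exact_mod_cast hk
  have hρpow := le_pow_extraDigits hq d k
  rw [← hρ] at hρpow
  have hMle : M ≤ d * 2 ^ (k + 1) := by
    refine (Finset.sum_le_card_nsmul _ _ _ fun j _ => (hh j).2.le).trans ?_
    simp
  have hR : M + ρ ≤ 4 * d * 2 ^ k := by
    have := extraDigits_le hq d k
    rw [pow_succ] at hMle
    nlinarith [Nat.one_le_two_pow (n := k)]
  refine ⟨q ^ (M + ρ), ?_, ?_⟩
  · calc k ≤ 2 ^ (k * d) * k := Nat.le_mul_of_pos_left _ (by positivity)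
      _ ≤ q ^ ρ := hρpow
      _ ≤ q ^ (M + ρ) := Nat.pow_le_pow_right (by lia) (by lia)
  · have hdisc := inv_pow_le_starDisc hq ⟨0, hd⟩ a h (fun j => (hh j).1) H
    rw [Finset.sum_add_distrib, Finset.sum_const, Finset.card_univ, Fintype.card_fin, smul_eq_mul,
      mul_one, ← hM] at hdisc
    have hlogN : Real.log ((q ^ (M + ρ) : ℕ) : ℝ) = (M + ρ : ℕ) * Real.log q := by
      rw [Nat.cast_pow, Real.log_pow]
    have hlog1 : Real.log ((q ^ (M + ρ) : ℕ) : ℝ) ≤ A * 2 ^ k := by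
      rw [hlogN, hA]
      have : ((M + ρ : ℕ) : ℝ) ≤ 4 * d * 2 ^ k := by exact_mod_cast hR
      nlinarith
    have hρ1 : 1 ≤ M + ρ := by
      by_contra hlt
      have hz : ρ = 0 := by lia
      rw [hz, pow_zero] at hρpow
      have : 1 < 2 ^ (k * d) := Nat.one_lt_two_pow (by positivity)
      nlinarith
    have hlog0 : 0 < Real.log ((q ^ (M + ρ) : ℕ) : ℝ) := by
      rw [hlogN]
      have : (1 : ℝ) ≤ (M + ρ : ℕ) := by exact_mod_cast hρ1
      positivity
    have hloglog : Real.log (Real.log ((q ^ (M + ρ) : ℕ) : ℝ)) ≤ (Real.log A + 1) * k := by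
      refine (Real.log_le_log hlog0 hlog1).trans ?_
      rw [Real.log_mul (by positivity) (by positivity), Real.log_pow]
      have : Real.log 2 ≤ 1 := by linarith [Real.log_two_lt_d9]
      nlinarith
    have hmain : Real.log ((q ^ (M + ρ) : ℕ) : ℝ) ^ d
        * Real.log (Real.log ((q ^ (M + ρ) : ℕ) : ℝ))
        ≤ (A ^ d * (Real.log A + 1)) * q ^ ρ := by
      calc _ ≤ Real.log ((q ^ (M + ρ) : ℕ) : ℝ) ^ d * ((Real.log A + 1) * k) :=
            mul_le_mul_of_nonneg_left hloglog (pow_nonneg hlog0.le d)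
        _ ≤ (A * 2 ^ k) ^ d * ((Real.log A + 1) * k) := by gcongr
        _ = (A ^ d * (Real.log A + 1)) * (2 ^ (k * d) * k) := by ring
        _ ≤ _ := by
          gcongr
          exact_mod_cast hρpow
    refine le_of_mul_le_mul_left (le_trans ?_ hdisc) four_pos
    rw [mul_assoc B⁻¹]
    calc 4 * (B⁻¹ * (Real.log ((q ^ (M + ρ) : ℕ) : ℝ) ^ d
        * Real.log (Real.log ((q ^ (M + ρ) : ℕ) : ℝ))) / ((q ^ (M + ρ) : ℕ) : ℝ))
        ≤ 4 * (B⁻¹ * ((A ^ d * (Real.log A + 1)) * q ^ ρ) / ((q ^ (M + ρ) : ℕ) : ℝ)) := by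
          gcongr
      _ = 1 / (q : ℝ) ^ (M + d) := by
          have : 0 < A ^ d * (Real.log A + 1) := by positivity
          rw [hB, Nat.cast_pow, pow_add, pow_add]
          field_simp

end Growth

section SecondMoment

variable {Ω ι : Type*} [MeasurableSpace Ω]

theorem two_mul_sum_sub_le_measureReal_biUnion (μ : Measure Ω) [IsFiniteMeasure μ]
    (I : Finset ι) (E : ι → Set Ω) (hE : ∀ i ∈ I, MeasurableSet (E i)) (s : ℝ) :
    2 * s * ∑ i ∈ I, μ.real (E i) - s ^ 2 * ∑ i ∈ I, ∑ j ∈ I, μ.real (E i ∩ E j)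
      ≤ μ.real (⋃ i ∈ I, E i) := by
  have hint (A : Set Ω) (hA : MeasurableSet A) :
      Integrable (A.indicator (1 : Ω → ℝ)) μ := (integrable_const 1).indicator hA
  have hU : MeasurableSet (⋃ i ∈ I, E i) := Finset.measurableSet_biUnion I hE
  have h1 : ∫ ω, (2 * s * ∑ i ∈ I, (E i).indicator (1 : Ω → ℝ) ω
      - s ^ 2 * ∑ i ∈ I, ∑ j ∈ I, (E i ∩ E j).indicator (1 : Ω → ℝ) ω) ∂μ
      = 2 * s * ∑ i ∈ I, μ.real (E i) - s ^ 2 * ∑ i ∈ I, ∑ j ∈ I, μ.real (E i ∩ E j) := by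
    rw [integral_sub, integral_const_mul, integral_const_mul, integral_finsetSum,
      integral_finsetSum]
    · congr 2
      · exact Finset.sum_congr rfl fun i hi => integral_indicator_one (hE i hi)
      · refine Finset.sum_congr rfl fun i hi => ?_
        rw [integral_finsetSum]
        · exact Finset.sum_congr rfl fun j hj =>
            integral_indicator_one ((hE i hi).inter (hE j hj))
        · exact fun j hj => hint _ ((hE i hi).inter (hE j hj))
    · exact fun i hi => integrable_finsetSum _ fun j hj => hint _ ((hE i hi).inter (hE j hj))
    · exact fun i hi => hint _ (hE i hi)
    · exact (integrable_finsetSum _ fun i hi => hint _ (hE i hi)).const_mul _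
    · exact (integrable_finsetSum _ fun i hi => integrable_finsetSum _ fun j hj =>
        hint _ ((hE i hi).inter (hE j hj))).const_mul _
  rw [← h1, ← integral_indicator_one hU]
  refine integral_mono ?_ (hint _ hU) fun ω => ?_
  · exact ((integrable_finsetSum _ fun i hi => hint _ (hE i hi)).const_mul _).sub
      ((integrable_finsetSum _ fun i hi => integrable_finsetSum _ fun j hj =>
        hint _ ((hE i hi).inter (hE j hj))).const_mul _)
  · have hsq : ∑ i ∈ I, ∑ j ∈ I, (E i ∩ E j).indicator (1 : Ω → ℝ) ω
        = (∑ i ∈ I, (E i).indicator (1 : Ω → ℝ) ω) ^ 2 := by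
      rw [sq, Finset.sum_mul_sum]
      simp_rw [Set.inter_indicator_one]
      rfl
    simp only [hsq]
    by_cases hω : ω ∈ ⋃ i ∈ I, E i
    · rw [Set.indicator_of_mem hω]
      simp only [Pi.one_apply]
      nlinarith [sq_nonneg (1 - s * ∑ i ∈ I, (E i).indicator (1 : Ω → ℝ) ω)]
    · rw [Set.indicator_of_notMem hω, Finset.sum_eq_zero]
      · simp
      · intro i hi
        exact Set.indicator_of_notMem (fun h => hω (Set.mem_biUnion hi h)) _

/-- The second moment method for a finite family of events. -/
theorem sum_div_le_measureReal_biUnion (μ : Measure Ω) [IsFiniteMeasure μ]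
    (I : Finset ι) (E : ι → Set Ω) (hE : ∀ i ∈ I, MeasurableSet (E i)) {B : ℝ} (hB : 0 < B)
    (h : ∑ i ∈ I, ∑ j ∈ I, μ.real (E i ∩ E j) ≤ B * ∑ i ∈ I, μ.real (E i)) :
    (∑ i ∈ I, μ.real (E i)) / B ≤ μ.real (⋃ i ∈ I, E i) := by
  refine le_trans ?_ (two_mul_sum_sub_le_measureReal_biUnion μ I E hE B⁻¹)
  have := mul_le_mul_of_nonneg_left h (sq_nonneg B⁻¹)
  have h2 : B⁻¹ ^ 2 * (B * ∑ i ∈ I, μ.real (E i)) = B⁻¹ * ∑ i ∈ I, μ.real (E i) := by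
    field_simp
  rw [div_eq_inv_mul]
  linarith

end SecondMoment

section FiniteDigits

variable {q d : ℕ}

/-- The index set of the first `n` digits of every coordinate. -/
def firstDigits (d n : ℕ) : Finset (Fin d × ℕ) := Finset.univ ×ˢ Finset.range n

theorem mem_firstDigits {d n : ℕ} {p : Fin d × ℕ} : p ∈ firstDigits d n ↔ p.2 < n := by
  simp [firstDigits]

theorem firstDigits_mono {d m n : ℕ} (h : m ≤ n) : firstDigits d m ⊆ firstDigits d n :=
  fun _ hp => mem_firstDigits.2 ((mem_firstDigits.1 hp).trans_le h)

/-- `A` depends only on the digits with indices in `s`. -/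
def DeterminedBy (s : Finset (Fin d × ℕ)) (A : Set (Fin d → ℕ → ZMod q)) : Prop :=
  ∀ ⦃a b : Fin d → ℕ → ZMod q⦄, (∀ p ∈ s, a p.1 p.2 = b p.1 p.2) → a ∈ A → b ∈ A

theorem DeterminedBy.mono {s t : Finset (Fin d × ℕ)} {A : Set (Fin d → ℕ → ZMod q)}
    (h : DeterminedBy s A) (hst : s ⊆ t) : DeterminedBy t A :=
  fun _ _ hab => h fun p hp => hab p (hst hp)

theorem DeterminedBy.inter {s : Finset (Fin d × ℕ)} {A B : Set (Fin d → ℕ → ZMod q)}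
    (hA : DeterminedBy s A) (hB : DeterminedBy s B) : DeterminedBy s (A ∩ B) :=
  fun _ _ hab h => ⟨hA hab h.1, hB hab h.2⟩

theorem DeterminedBy.compl {s : Finset (Fin d × ℕ)} {A : Set (Fin d → ℕ → ZMod q)}
    (hA : DeterminedBy s A) : DeterminedBy s Aᶜ :=
  fun _ _ hab h h' => h (hA (fun p hp => (hab p hp).symm) h')

/-- The restriction of a coefficient sequence to the digits with indices in `s`. -/
def restrictDigits (s : Finset (Fin d × ℕ)) (a : Fin d → ℕ → ZMod q) : s → ZMod q :=
  fun p => a p.1.1 p.1.2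

theorem DeterminedBy.preimage_image {s : Finset (Fin d × ℕ)} {A : Set (Fin d → ℕ → ZMod q)}
    (hA : DeterminedBy s A) : restrictDigits s ⁻¹' (restrictDigits s '' A) = A := by
  refine Set.Subset.antisymm ?_ (Set.subset_preimage_image _ _)
  rintro b ⟨a, ha, hab⟩
  exact hA (fun p hp => congrFun hab ⟨p, hp⟩) ha

theorem measurableSet_digit_eq (j : Fin d) (l : ℕ) (t : ZMod q) :
    MeasurableSet {a : Fin d → ℕ → ZMod q | a j l = t} := by
  have h : Measurable fun a : Fin d → ℕ → ZMod q => a j l :=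
    (measurable_pi_apply l).comp (measurable_pi_apply j)
  exact h (show MeasurableSet ({t} : Set (ZMod q)) from trivial)

theorem measurableSet_restrictDigits_preimage_singleton (s : Finset (Fin d × ℕ))
    (w : s → ZMod q) : MeasurableSet (restrictDigits s ⁻¹' {w}) := by
  have : restrictDigits s ⁻¹' {w} = ⋂ p : s, {a | a p.1.1 p.1.2 = w p} := by
    ext a
    simp [restrictDigits, funext_iff]
  rw [this]
  exact MeasurableSet.iInter fun p => measurableSet_digit_eq _ _ _

/-- Under `μ` all digits are independent and uniformly distributed. -/
def UniformDigits (μ : Measure (Fin d → ℕ → ZMod q)) : Prop :=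
  ∀ (s : Finset (Fin d × ℕ)) (v : Fin d × ℕ → ZMod q),
    μ {a | ∀ p ∈ s, a p.1 p.2 = v p} = ((q : ENNReal))⁻¹ ^ s.card

theorem UniformDigits.measureReal_eq {μ : Measure (Fin d → ℕ → ZMod q)} (hμ : UniformDigits μ)
    (s : Finset (Fin d × ℕ)) (v : Fin d × ℕ → ZMod q) :
    μ.real {a | ∀ p ∈ s, a p.1 p.2 = v p} = ((q : ℝ))⁻¹ ^ s.card := by
  rw [Measure.real, hμ s v]
  simp

theorem UniformDigits.measureReal_restrictDigits_preimage_singleton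
    {μ : Measure (Fin d → ℕ → ZMod q)} (hμ : UniformDigits μ) (s : Finset (Fin d × ℕ))
    (w : s → ZMod q) : μ.real (restrictDigits s ⁻¹' {w}) = ((q : ℝ))⁻¹ ^ s.card := by
  classical
  rw [← hμ.measureReal_eq s fun p => if h : p ∈ s then w ⟨p, h⟩ else 0]
  congr 1
  ext a
  simp only [Set.mem_preimage, Set.mem_singleton_iff, funext_iff, restrictDigits, Set.mem_ofPred_eq,
    Subtype.forall]
  exact forall_congr' fun p => forall_congr' fun hp => by rw [dif_pos hp]

variable [NeZero q]

theorem DeterminedBy.measurableSet {s : Finset (Fin d × ℕ)} {A : Set (Fin d → ℕ → ZMod q)}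
    (hA : DeterminedBy s A) : MeasurableSet A := by
  rw [← hA.preimage_image, ← Set.biUnion_preimage_singleton]
  exact MeasurableSet.biUnion (Set.toFinite _).countable fun w _ =>
    measurableSet_restrictDigits_preimage_singleton s w

theorem UniformDigits.measureReal_restrictDigits_preimage
    {μ : Measure (Fin d → ℕ → ZMod q)} [IsFiniteMeasure μ] (hμ : UniformDigits μ)
    (s : Finset (Fin d × ℕ)) (T : Set (s → ZMod q)) :
    μ.real (restrictDigits s ⁻¹' T) = Nat.card T * ((q : ℝ))⁻¹ ^ s.card := by
  have h := sum_measureReal_preimage_singleton (μ := μ) (Set.toFinite T).toFinset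
    (f := restrictDigits s) fun w _ => measurableSet_restrictDigits_preimage_singleton s w
  rw [Set.Finite.coe_toFinset] at h
  rw [← h, Finset.sum_congr rfl fun w _ => hμ.measureReal_restrictDigits_preimage_singleton s w,
    Finset.sum_const, nsmul_eq_mul, Nat.card_eq_card_finite_toFinset]

/-- Prescribing one digit as a function of finitely many other ones divides probabilities by
`q`. -/
theorem UniformDigits.measureReal_inter_digit_eq
    {μ : Measure (Fin d → ℕ → ZMod q)} [IsFiniteMeasure μ] (hμ : UniformDigits μ)
    {s : Finset (Fin d × ℕ)} {A : Set (Fin d → ℕ → ZMod q)} (hA : DeterminedBy s A)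
    {p : Fin d × ℕ} (hp : p ∉ s) (g : (Fin d → ℕ → ZMod q) → ZMod q)
    (hg : ∀ a b : Fin d → ℕ → ZMod q, (∀ p ∈ s, a p.1 p.2 = b p.1 p.2) → g a = g b) :
    μ.real (A ∩ {a | a p.1 p.2 = g a}) = ((q : ℝ))⁻¹ * μ.real A := by
  classical
  let ext (w : s → ZMod q) : Fin d → ℕ → ZMod q :=
    fun j l => if h : (j, l) ∈ s then w ⟨(j, l), h⟩ else 0
  have hext (w : s → ZMod q) (a : Fin d → ℕ → ZMod q) (ha : restrictDigits s a = w) :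
      ∀ p ∈ s, ext w p.1 p.2 = a p.1 p.2 := by
    intro p hp
    simp only [ext, dif_pos (show (p.1, p.2) ∈ s from hp), ← ha]
    rfl
  set T := (Set.toFinite (restrictDigits s '' A)).toFinset with hT
  have hA' : A = ⋃ w ∈ T, restrictDigits s ⁻¹' {w} := by
    conv_lhs => rw [← hA.preimage_image]
    ext a
    simp [hT, eq_comm]
  have hB' : A ∩ {a | a p.1 p.2 = g a}
      = ⋃ w ∈ T, (restrictDigits s ⁻¹' {w} ∩ {a | a p.1 p.2 = g (ext w)}) := by
    conv_lhs => rw [hA', Set.iUnion₂_inter]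
    refine Set.iUnion₂_congr fun w _ => ?_
    ext a
    refine and_congr_right fun ha => ?_
    rw [Set.mem_ofPred_eq, Set.mem_ofPred_eq, hg _ _ (hext w a ha)]
  have hdisj : Set.PairwiseDisjoint (T : Set (s → ZMod q))
      fun w => restrictDigits s ⁻¹' {w} := fun w _ w' _ hne =>
    Disjoint.preimage _ (Set.disjoint_singleton.2 hne)
  have hterm (w : s → ZMod q) :
      μ.real (restrictDigits s ⁻¹' {w} ∩ {a | a p.1 p.2 = g (ext w)})
        = ((q : ℝ))⁻¹ * μ.real (restrictDigits s ⁻¹' {w}) := by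
    rw [hμ.measureReal_restrictDigits_preimage_singleton, ← pow_succ',
      ← Finset.card_insert_of_notMem hp,
      ← hμ.measureReal_eq (insert p s) fun x => if x = p then g (ext w) else ext w x.1 x.2]
    congr 1
    ext a
    simp only [Set.mem_inter_iff, Set.mem_preimage, Set.mem_singleton_iff, Set.mem_ofPred_eq,
      Finset.forall_mem_insert, if_true]
    rw [and_comm]
    refine and_congr_right fun _ => ⟨fun ha x hx => ?_, fun ha => ?_⟩
    · rw [if_neg (ne_of_mem_of_not_mem hx hp), hext w a ha x hx]
    · funext x
      have := ha x.1 x.2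
      rw [if_neg (ne_of_mem_of_not_mem x.2 hp)] at this
      simp only [restrictDigits, this, ext]
      exact dif_pos x.2
  rw [hB', measureReal_biUnion_finset, Finset.sum_congr rfl fun w _ => hterm w, ← Finset.mul_sum,
    ← measureReal_biUnion_finset hdisj, ← hA']
  · exact fun w _ => measurableSet_restrictDigits_preimage_singleton s w
  · exact hdisj.mono fun w => Set.inter_subset_left
  · exact fun w _ => (measurableSet_restrictDigits_preimage_singleton s w).inter
      (measurableSet_digit_eq _ _ _)

end FiniteDigits

section Convergents

open Polynomial

variable {F : Type*} [Field F]

/-- The first `r` digits of the fractional part of the product of `p` with the Laurent series with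
coefficients `b` vanish. -/
def PairVanish (b : ℕ → F) (p : F[X]) (r : ℕ) : Prop :=
  ∀ c : F[X], c.degree < r → digitPairing b (c * p) = 0

theorem pairVanish_iff {b : ℕ → F} {p : F[X]} {r : ℕ} :
    PairVanish b p r ↔ ∀ i < r, digitPairing b (X ^ i * p) = 0 := by
  refine ⟨fun h i hi => h _ (by rw [degree_X_pow]; exact_mod_cast hi), fun h c hc => ?_⟩
  have H : DigitsVanish (fun _ : Fin 1 => b) (fun _ => p) r := fun i hi => by
    simpa [vecPairing_apply] using h i hi
  simpa [vecPairing_apply] using H.mul hc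

theorem PairVanish.mono {b : ℕ → F} {p : F[X]} {r s : ℕ} (h : PairVanish b p s) (hrs : r ≤ s) :
    PairVanish b p r :=
  fun c hc => h c (hc.trans_le (by exact_mod_cast hrs))

theorem PairVanish.sub {b : ℕ → F} {p p' : F[X]} {r : ℕ} (h : PairVanish b p r)
    (h' : PairVanish b p' r) : PairVanish b (p - p') r := fun c hc => by
  rw [mul_sub, map_sub, h c hc, h' c hc, sub_zero]

theorem exists_pairVanish (b : ℕ → F) (M : ℕ) :
    ∃ p : F[X], p ≠ 0 ∧ p.natDegree ≤ M ∧ PairVanish b p M := by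
  let φ : degreeLT F (M + 1) →ₗ[F] (Fin M → F) :=
    LinearMap.pi fun i => (digitPairing b).comp
      ((LinearMap.mulLeft F (X ^ (i : ℕ))).comp (degreeLT F (M + 1)).subtype)
  have hker : LinearMap.ker φ ≠ ⊥ := by
    have := (degreeLTEquiv F (M + 1)).finrank_eq
    have := (degreeLTEquiv F (M + 1)).symm.finiteDimensional
    apply LinearMap.ker_ne_bot_of_finrank_lt
    simp_all
  obtain ⟨p, hp, hp0⟩ := Submodule.exists_mem_ne_zero_of_ne_bot hker
  have hp0' : (p : F[X]) ≠ 0 := by simpa using hp0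
  refine ⟨p, hp0', ?_, pairVanish_iff.2 fun i hi => congrFun (LinearMap.mem_ker.1 hp) ⟨i, hi⟩⟩
  have := mem_degreeLT.1 p.2
  exact Nat.lt_succ_iff.1 ((natDegree_lt_iff_degree_lt hp0').2 this)

/-- The `k`-th Hankel determinant of `b` does not vanish. -/
def IsNormalIndex (b : ℕ → F) (k : ℕ) : Prop :=
  ∀ p : F[X], p ≠ 0 → p.natDegree < k → ¬ PairVanish b p k

/-- There is a convergent denominator of degree `k` that approximates to order at least `M`. -/
def IsConvergent (b : ℕ → F) (k M : ℕ) : Prop :=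
  IsNormalIndex b k ∧ ∃ p : F[X], p.Monic ∧ p.natDegree = k ∧ PairVanish b p M

theorem IsConvergent.mono {b : ℕ → F} {k M N : ℕ} (h : IsConvergent b k N) (hMN : M ≤ N) :
    IsConvergent b k M :=
  let ⟨p, hp, hk, hv⟩ := h.2
  ⟨h.1, p, hp, hk, hv.mono hMN⟩

theorem exists_isConvergent (b : ℕ → F) (M : ℕ) : ∃ k ≤ M, IsConvergent b k M := by
  classical
  have hex : ∃ k, ∃ p : F[X], p ≠ 0 ∧ p.natDegree = k ∧ PairVanish b p M :=
    let ⟨p, h0, _, hv⟩ := exists_pairVanish b M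
    ⟨_, p, h0, rfl, hv⟩
  obtain ⟨g, hg0, hgk, hgv⟩ := Nat.find_spec hex
  have hmin : ∀ p : F[X], p ≠ 0 → p.natDegree < Nat.find hex → ¬ PairVanish b p M :=
    fun p h0 hlt hv => Nat.find_min hex hlt ⟨p, h0, rfl, hv⟩
  refine ⟨Nat.find hex, ?_, ?_⟩
  · obtain ⟨p, h0, hd, hv⟩ := exists_pairVanish b M
    exact (Nat.find_min' hex ⟨p, h0, rfl, hv⟩).trans hd
  set k := Nat.find hex
  set h := g * C g.leadingCoeff⁻¹ with hh
  have hm : h.Monic := monic_mul_leadingCoeff_inv hg0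
  have hk : h.natDegree = k := by rw [hh, natDegree_mul_leadingCoeff_inv _ hg0, hgk]
  have hv : PairVanish b h M := fun c hc => by
    rw [hh, mul_comm g, mul_left_comm, C_mul', map_smul, hgv c hc, smul_zero]
  refine ⟨fun p hp0 hpk hpv => hmin p hp0 hpk fun c hc => ?_, h, hm, hk, hv⟩
  rw [← modByMonic_add_div c h, add_mul, map_add, hpv, zero_add, mul_assoc, mul_comm h, hv]
  · by_cases hck : c.degree < h.degree
    · rw [(divByMonic_eq_zero_iff hm).2 hck, zero_mul, degree_zero]
      exact WithBot.bot_lt_coe _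
    · have hc0 : c ≠ 0 := by
        rintro rfl
        exact hck (by rw [degree_zero]; exact bot_lt_iff_ne_bot.2 (degree_ne_bot.2 hm.ne_zero))
      have h1 : h.natDegree ≤ c.natDegree := natDegree_le_natDegree (not_lt.1 hck)
      have h2 : c.natDegree < M := (natDegree_lt_iff_degree_lt hc0).2 hc
      refine degree_le_natDegree.trans_lt ?_
      have h3 := natDegree_mul_le (p := c /ₘ h) (q := p)
      rw [natDegree_divByMonic _ hm] at h3
      exact_mod_cast (show (c /ₘ h * p).natDegree < M by lia)
  · rw [← hk, ← degree_eq_natDegree hm.ne_zero]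
    exact degree_modByMonic_lt _ hm

theorem IsConvergent.not_isNormalIndex {b : ℕ → F} {k l M : ℕ} (h : IsConvergent b k M)
    (hkl : k < l) (hlM : l ≤ M) : ¬ IsNormalIndex b l := fun hl => by
  obtain ⟨p, hp, hpk, hv⟩ := h.2
  exact hl p hp.ne_zero (hpk ▸ hkl) (hv.mono hlM)

theorem IsConvergent.eq {b : ℕ → F} {k l M : ℕ} (h : IsConvergent b k M)
    (h' : IsConvergent b l M) (hk : k ≤ M) (hl : l ≤ M) : k = l := by
  rcases lt_trichotomy k l with hlt | rfl | hlt
  · exact absurd h'.1 (h.not_isNormalIndex hlt hl)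
  · rfl
  · exact absurd h.1 (h'.not_isNormalIndex hlt hk)

/-- The value of the next digit for which a convergent denominator of degree `k` and
approximation order `M` remains one to order `M + 1`. -/
noncomputable def forcedDigit (b : ℕ → F) (k M : ℕ) : F :=
  -∑ l ∈ Finset.range k,
    (Classical.epsilon fun p : F[X] => p.Monic ∧ p.natDegree = k ∧ PairVanish b p M).coeff l
      * b (M + l)

theorem isConvergent_succ_iff {b : ℕ → F} {k M : ℕ} (hk : k ≤ M) :
    IsConvergent b k (M + 1) ↔ IsConvergent b k M ∧ b (M + k) = forcedDigit b k M := by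
  have key (p : F[X]) (hp : p.Monic) (hpk : p.natDegree = k) (hv : PairVanish b p M)
      (hn : IsNormalIndex b k) :
      digitPairing b (X ^ M * p) = b (M + k) - forcedDigit b k M := by
    have hspec := Classical.epsilon_spec
      (p := fun p : F[X] => p.Monic ∧ p.natDegree = k ∧ PairVanish b p M) ⟨p, hp, hpk, hv⟩
    rw [forcedDigit]
    set p' := Classical.epsilon fun p : F[X] => p.Monic ∧ p.natDegree = k ∧ PairVanish b p M
    have hpp : p' = p := by
      by_contra hne
      have hne' : p' - p ≠ 0 := sub_ne_zero.2 hne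
      refine hn _ hne' ?_ ((hspec.2.2.sub hv).mono hk)
      rw [natDegree_lt_iff_degree_lt hne']
      have := degree_sub_lt_left (p := p') (q := p)
        (by rw [degree_eq_natDegree hspec.1.ne_zero, degree_eq_natDegree hp.ne_zero, hspec.2.1,
          hpk]) hspec.1.ne_zero (by rw [hspec.1.leadingCoeff, hp.leadingCoeff])
      rwa [degree_eq_natDegree hspec.1.ne_zero, hspec.2.1] at this
    rw [hpp, digitPairing_X_pow_mul b M (n := k + 1) (by lia), Finset.sum_range_succ, ← hpk,
      coeff_natDegree, hp.leadingCoeff]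
    ring
  constructor
  · rintro h
    refine ⟨h.mono M.le_succ, ?_⟩
    obtain ⟨p, hp, hpk, hv⟩ := h.2
    have := key p hp hpk (hv.mono M.le_succ) h.1
    rw [pairVanish_iff.1 hv M M.lt_succ_self] at this
    exact (sub_eq_zero.1 this.symm)
  · rintro ⟨⟨hn, p, hp, hpk, hv⟩, hb⟩
    refine ⟨hn, p, hp, hpk, pairVanish_iff.2 fun i hi => ?_⟩
    rcases Nat.lt_succ_iff_lt_or_eq.1 hi with hi | rfl
    · exact pairVanish_iff.1 hv i hi
    · rw [key p hp hpk hv hn, hb, sub_self]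

theorem PairVanish.congr {b b' : ℕ → F} {p : F[X]} {r : ℕ}
    (h : ∀ i < r + p.natDegree, b i = b' i) (hv : PairVanish b p r) : PairVanish b' p r := by
  rw [pairVanish_iff] at hv ⊢
  intro i hi
  rw [← hv i hi, digitPairing_X_pow_mul _ i p.natDegree.lt_succ_self,
    digitPairing_X_pow_mul _ i p.natDegree.lt_succ_self]
  refine Finset.sum_congr rfl fun l hl => ?_
  rw [h]
  have := Finset.mem_range.1 hl
  lia

theorem IsConvergent.congr {b b' : ℕ → F} {k M : ℕ} (hk : k ≤ M)
    (h : ∀ i < M + k, b i = b' i) (hc : IsConvergent b k M) : IsConvergent b' k M := by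
  obtain ⟨hn, p, hp, hpk, hv⟩ := hc
  exact ⟨fun g hg0 hgk hgv => hn g hg0 hgk (hgv.congr fun i hi => (h i (by lia)).symm),
    p, hp, hpk, hv.congr fun i hi => h i (by lia)⟩

theorem forcedDigit_congr {b b' : ℕ → F} {k M : ℕ} (h : ∀ i < M + k, b i = b' i) :
    forcedDigit b k M = forcedDigit b' k M := by
  have : (fun p : F[X] => p.Monic ∧ p.natDegree = k ∧ PairVanish b p M)
      = fun p : F[X] => p.Monic ∧ p.natDegree = k ∧ PairVanish b' p M := by
    funext p
    refine propext (and_congr_right fun _ => and_congr_right fun hpk => ⟨?_, ?_⟩)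
    · exact PairVanish.congr fun i hi => h i (by lia)
    · exact PairVanish.congr fun i hi => (h i (by lia)).symm
  rw [forcedDigit, forcedDigit, this]
  congr 1
  refine Finset.sum_congr rfl fun l hl => ?_
  rw [h]
  have := Finset.mem_range.1 hl
  lia

end Convergents

section SingleSeries

open Polynomial

theorem sum_Ico_two_pow_log (f : ℕ → ℝ) {m n : ℕ} (h : m ≤ n) :
    ∑ M ∈ Finset.Ico (2 ^ m) (2 ^ n), f (Nat.log 2 M) = ∑ k ∈ Finset.Ico m n, 2 ^ k * f k := by
  induction n, h using Nat.le_induction with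
  | base => simp
  | succ n hmn ih =>
    rw [Finset.sum_Ico_succ_top hmn, ← ih,
      ← Finset.sum_Ico_consecutive _ (Nat.pow_le_pow_right two_pos hmn)
        (Nat.pow_le_pow_right two_pos n.le_succ)]
    congr 1
    rw [Finset.sum_congr rfl fun M hM => by
      rw [Nat.log_eq_of_pow_le_of_lt_pow (Finset.mem_Ico.1 hM).1 (Finset.mem_Ico.1 hM).2],
      Finset.sum_const, Nat.card_Ico, nsmul_eq_mul]
    have : 2 ^ (n + 1) - 2 ^ n = 2 ^ n := by rw [pow_succ]; lia
    rw [this]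
    push_cast
    rfl

variable {q : ℕ} [Fact q.Prime]

/-- The sequences having a convergent denominator of degree `k` with approximation order at least
`M`. -/
def convergentSet (q k M : ℕ) [Fact q.Prime] : Set (Fin 1 → ℕ → ZMod q) :=
  {a | IsConvergent (a 0) k M}

theorem determinedBy_convergentSet {k M : ℕ} (hk : k ≤ M) :
    DeterminedBy (firstDigits 1 (M + k)) (convergentSet q k M) := fun _ _ hab ha =>
  IsConvergent.congr hk (fun i hi => hab (0, i) (mem_firstDigits.2 hi)) ha

variable {μ : Measure (Fin 1 → ℕ → ZMod q)} [IsFiniteMeasure μ]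
  {C : Set (Fin 1 → ℕ → ZMod q)}

theorem measureReal_convergentSet_add (hμ : UniformDigits μ) {k M : ℕ} (hk : k ≤ M)
    (hC : DeterminedBy (firstDigits 1 (M + k)) C) (r : ℕ) :
    μ.real (convergentSet q k (M + r) ∩ C)
      = ((q : ℝ)⁻¹) ^ r * μ.real (convergentSet q k M ∩ C) := by
  induction r with
  | zero => simp
  | succ r ih =>
    have hA : DeterminedBy (firstDigits 1 (M + r + k)) (convergentSet q k (M + r) ∩ C) :=
      (determinedBy_convergentSet (by lia)).inter (hC.mono (firstDigits_mono (by lia)))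
    have h := hμ.measureReal_inter_digit_eq hA (p := (0, M + r + k))
      (fun h => (mem_firstDigits.1 h).ne rfl) (fun a => forcedDigit (a 0) k (M + r))
      fun a b hab => forcedDigit_congr fun i hi => hab (0, i) (mem_firstDigits.2 hi)
    rw [pow_succ', mul_assoc, ← ih, ← h]
    congr 1
    ext a
    simp only [convergentSet, Set.mem_inter_iff, Set.mem_ofPred_eq, ← add_assoc,
      isConvergent_succ_iff (b := a 0) (show k ≤ M + r by lia)]
    tauto

theorem sum_measureReal_convergentSet {K : ℕ} (hC : DeterminedBy (firstDigits 1 K) C) (M : ℕ) :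
    ∑ k ∈ Finset.range (M + 1), μ.real (convergentSet q k M ∩ C) = μ.real C := by
  rw [← measureReal_biUnion_finset]
  · congr 1
    ext a
    simp only [Set.mem_iUnion, Finset.mem_range, Nat.lt_succ_iff, exists_prop, Set.mem_inter_iff]
    constructor
    · rintro ⟨k, _, _, h⟩
      exact h
    · intro h
      obtain ⟨k, hk, hc⟩ := exists_isConvergent (a 0) M
      exact ⟨k, hk, hc, h⟩
  · intro k hk l hl hkl
    refine Set.disjoint_left.2 fun a ha hb => hkl ?_
    exact IsConvergent.eq ha.1 hb.1 (Nat.lt_succ_iff.1 (Finset.mem_range.1 hk))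
      (Nat.lt_succ_iff.1 (Finset.mem_range.1 hl))
  · intro k hk
    exact (determinedBy_convergentSet
      (Nat.lt_succ_iff.1 (Finset.mem_range.1 hk))).measurableSet.inter hC.measurableSet

theorem measureReal_convergentSet_self (hμ : UniformDigits μ) {M : ℕ}
    (hC : DeterminedBy (firstDigits 1 M) C) :
    μ.real (convergentSet q (M + 1) (M + 1) ∩ C) = (1 - (q : ℝ)⁻¹) * μ.real C := by
  have h1 := sum_measureReal_convergentSet (μ := μ) hC M
  have h2 := sum_measureReal_convergentSet (μ := μ) hC (M + 1)
  rw [Finset.sum_range_succ, Finset.sum_congr rfl fun k hk =>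
    measureReal_convergentSet_add hμ (Nat.lt_succ_iff.1 (Finset.mem_range.1 hk))
      (hC.mono (firstDigits_mono (by lia))) 1, ← Finset.mul_sum, h1, pow_one] at h2
  linarith

/-- The sequences having a convergent denominator of degree `M` of exceptionally good
approximation order. -/
def goodConvergentSet (q M : ℕ) [Fact q.Prime] : Set (Fin 1 → ℕ → ZMod q) :=
  convergentSet q M (M + extraDigits q 1 (Nat.log 2 M))

theorem determinedBy_goodConvergentSet (M : ℕ) :
    DeterminedBy (firstDigits 1 (M + extraDigits q 1 (Nat.log 2 M) + M))
      (goodConvergentSet q M) :=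
  determinedBy_convergentSet (by lia)

theorem goodConvergentSet_subset (M : ℕ) :
    goodConvergentSet q M ⊆ exceptionalSet q 1 (Nat.log 2 M) := by
  rintro a ⟨_, p, hp, hpk, hv⟩
  refine ⟨fun _ => p, fun _ => ⟨hp, hpk ▸ Nat.lt_pow_succ_log_self one_lt_two _⟩, fun i hi => ?_⟩
  rw [vecPairing_apply, Fin.sum_univ_one]
  refine pairVanish_iff.1 hv i ?_
  simpa [hpk] using hi

theorem measureReal_goodConvergentSet (hμ : UniformDigits μ) {K M : ℕ} (hKM : K < M)
    (hC : DeterminedBy (firstDigits 1 K) C) :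
    μ.real (goodConvergentSet q M ∩ C)
      = (1 - (q : ℝ)⁻¹) * μ.real C * ((q : ℝ)⁻¹) ^ extraDigits q 1 (Nat.log 2 M) := by
  obtain ⟨N, rfl⟩ : ∃ N, M = N + 1 := ⟨M - 1, by lia⟩
  rw [goodConvergentSet, measureReal_convergentSet_add hμ le_rfl
    (hC.mono (firstDigits_mono (by lia))),
    measureReal_convergentSet_self hμ (hC.mono (firstDigits_mono (by lia))), mul_comm]

theorem measureReal_goodConvergentSet_inter_le (hμ : UniformDigits μ) {K i j : ℕ} (hKi : K < i)
    (hij : i < j) (hC : DeterminedBy (firstDigits 1 K) C) :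
    μ.real (goodConvergentSet q i ∩ goodConvergentSet q j ∩ C)
      ≤ μ.real (goodConvergentSet q i ∩ C)
        * ((q : ℝ)⁻¹) ^ extraDigits q 1 (Nat.log 2 j) := by
  by_cases h : i + extraDigits q 1 (Nat.log 2 i) + i ≤ j + j
  · have hC' : DeterminedBy (firstDigits 1 (j + j)) (goodConvergentSet q i ∩ C) :=
      ((determinedBy_goodConvergentSet i).mono (firstDigits_mono h)).inter
        (hC.mono (firstDigits_mono (by lia)))
    have h1 := measureReal_convergentSet_add hμ le_rfl hC' (extraDigits q 1 (Nat.log 2 j))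
    rw [Set.inter_comm (goodConvergentSet q i), Set.inter_assoc]
    refine h1.le.trans ?_
    rw [mul_comm]
    exact mul_le_mul_of_nonneg_right (measureReal_mono Set.inter_subset_right) (by positivity)
  · have : goodConvergentSet q i ∩ goodConvergentSet q j = ∅ := by
      ext a
      simp only [Set.mem_inter_iff, Set.mem_empty_iff_false, iff_false, not_and]
      exact fun hi hj => IsConvergent.not_isNormalIndex hi hij (by lia) hj.1
    rw [this, Set.empty_inter, measureReal_empty]
    positivity

theorem sum_measureReal_goodConvergentSet_inter_le (hμ : UniformDigits μ) {K : ℕ}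
    (hC : DeterminedBy (firstDigits 1 K) C) (T : Finset ℕ) (hT : ∀ M ∈ T, K < M) :
    ∑ i ∈ T, ∑ j ∈ T, μ.real (goodConvergentSet q i ∩ goodConvergentSet q j ∩ C)
      ≤ (1 + 2 * ∑ M ∈ T, ((q : ℝ)⁻¹) ^ extraDigits q 1 (Nat.log 2 M))
        * ∑ M ∈ T, μ.real (goodConvergentSet q M ∩ C) := by
  set e : ℕ → ℝ := fun M => μ.real (goodConvergentSet q M ∩ C)
  set f : ℕ → ℝ := fun M => ((q : ℝ)⁻¹) ^ extraDigits q 1 (Nat.log 2 M)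
  have he (M) : 0 ≤ e M := measureReal_nonneg
  have hf (M) : 0 ≤ f M := by positivity
  have hpair (i) (hi : i ∈ T) (j) (hj : j ∈ T) :
      μ.real (goodConvergentSet q i ∩ goodConvergentSet q j ∩ C)
        ≤ (if i = j then e i else 0) + (e i * f j + e j * f i) := by
    have h1 := mul_nonneg (he i) (hf j)
    have h2 := mul_nonneg (he j) (hf i)
    rcases lt_trichotomy i j with hij | rfl | hij
    · have := measureReal_goodConvergentSet_inter_le hμ (hT i hi) hij hC
      rw [if_neg hij.ne]
      linarith
    · rw [Set.inter_self, if_pos rfl]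
      linarith
    · have := measureReal_goodConvergentSet_inter_le hμ (hT j hj) hij hC
      rw [if_neg hij.ne', Set.inter_comm (goodConvergentSet q i)]
      linarith
  refine (Finset.sum_le_sum fun i hi => Finset.sum_le_sum fun j hj => hpair i hi j hj).trans ?_
  simp only [Finset.sum_add_distrib, ← Finset.mul_sum, ← Finset.sum_mul, Finset.sum_ite_eq]
  refine le_of_eq ?_
  rw [Finset.sum_ite_mem, Finset.inter_self]
  ring

theorem exists_measureReal_diff_goodConvergentSet_le (hμ : UniformDigits μ) {K : ℕ}
    (hC : DeterminedBy (firstDigits 1 K) C) (k₀ : ℕ) :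
    ∃ T : Finset ℕ, (∀ M ∈ T, 2 ^ k₀ ≤ M) ∧
      μ.real (C \ ⋃ M ∈ T, goodConvergentSet q M) ≤ 5 / 6 * μ.real C := by
  have hq1 : 1 < q := (Fact.out : q.Prime).one_lt
  have hq : (2 : ℝ) ≤ q := by exact_mod_cast hq1
  set k := max (K + 1) k₀ with hk
  obtain ⟨k', hk'⟩ := exists_lt_sum_Ico_inv q k
  have hkk : k ≤ k' := by
    by_contra h
    rw [Finset.Ico_eq_empty (by lia), Finset.sum_empty] at hk'
    linarith
  set T := Finset.Ico (2 ^ k) (2 ^ k') with hT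
  have hTk (M) (hM : M ∈ T) : 2 ^ k ≤ M := (Finset.mem_Ico.1 hM).1
  have hTK (M) (hM : M ∈ T) : K < M :=
    ((Nat.lt_succ_self K).trans_le (le_max_left _ _)).trans
      (Nat.lt_two_pow_self.trans_le (hTk M hM))
  refine ⟨T, fun M hM =>
    (Nat.pow_le_pow_right two_pos (le_max_right _ _)).trans (hTk M hM), ?_⟩
  set σ := ∑ M ∈ T, ((q : ℝ)⁻¹) ^ extraDigits q 1 (Nat.log 2 M) with hσ
  have hσ1 : 1 ≤ σ := by
    rw [hσ, hT, sum_Ico_two_pow_log (fun k => ((q : ℝ)⁻¹) ^ extraDigits q 1 k) hkk]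
    calc (1 : ℝ) = (q : ℝ)⁻¹ * q := by field_simp
      _ ≤ (q : ℝ)⁻¹ * ∑ l ∈ Finset.Ico k k', ((l : ℝ))⁻¹ := by gcongr
      _ = ∑ l ∈ Finset.Ico k k', ((q : ℝ) * l)⁻¹ := by
        simp only [Finset.mul_sum, mul_inv]
      _ ≤ _ := Finset.sum_le_sum fun l hl => by
        have := (Finset.mem_Ico.1 hl).1
        simpa using inv_le_two_pow_mul_inv_pow_extraDigits hq1 le_rfl (k := l) (by lia)
  have hE (M) : MeasurableSet (goodConvergentSet q M) :=
    (determinedBy_goodConvergentSet M).measurableSet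
  have hsum : ∑ M ∈ T, μ.real (goodConvergentSet q M ∩ C) = (1 - (q : ℝ)⁻¹) * μ.real C * σ := by
    rw [hσ, Finset.mul_sum]
    exact Finset.sum_congr rfl fun M hM => measureReal_goodConvergentSet hμ (hTK M hM) hC
  have h2 := sum_div_le_measureReal_biUnion (μ.restrict C) T (fun M => goodConvergentSet q M)
    (fun M _ => hE M) (B := 1 + 2 * σ) (by linarith) (by
      simp only [measureReal_restrict_apply (hE _),
        measureReal_restrict_apply ((hE _).inter (hE _))]
      exact sum_measureReal_goodConvergentSet_inter_le hμ hC T hTK)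
  have hU : MeasurableSet (⋃ M ∈ T, goodConvergentSet q M) :=
    Finset.measurableSet_biUnion T fun M _ => hE M
  simp only [measureReal_restrict_apply (hE _), measureReal_restrict_apply hU] at h2
  have hdiff := measureReal_sdiff_add_inter (μ := μ) (s := C) hU
  rw [Set.inter_comm] at hdiff
  rw [hsum, div_le_iff₀ (by linarith)] at h2
  have hq2 : (q : ℝ)⁻¹ ≤ 1 / 2 := by
    rw [inv_eq_one_div]
    exact one_div_le_one_div_of_le two_pos hq
  have hC0 : 0 ≤ μ.real C := measureReal_nonneg
  set u := μ.real ((⋃ M ∈ T, goodConvergentSet q M) ∩ C)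
  have h3 : 1 / 2 * μ.real C * σ ≤ u * (1 + 2 * σ) := by
    refine le_trans ?_ h2
    gcongr
    linarith
  have hu : 0 ≤ u := measureReal_nonneg
  have h4 : 1 / 2 * μ.real C * σ ≤ 3 * u * σ := by nlinarith
  have h5 : 1 / 2 * μ.real C ≤ 3 * u := le_of_mul_le_mul_right h4 (by linarith)
  linarith

theorem measure_forall_notMem_exceptionalSet_one [IsProbabilityMeasure μ] (hμ : UniformDigits μ)
    (k₀ : ℕ) : μ {a | ∀ k ≥ k₀, a ∉ exceptionalSet q 1 k} = 0 := by
  have key (i : ℕ) : ∃ (C : Set (Fin 1 → ℕ → ZMod q)) (K : ℕ), DeterminedBy (firstDigits 1 K) C ∧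
      {a | ∀ k ≥ k₀, a ∉ exceptionalSet q 1 k} ⊆ C ∧ μ.real C ≤ (5 / 6) ^ i := by
    induction i with
    | zero => exact ⟨Set.univ, 0, fun _ _ _ _ => trivial, Set.subset_univ _, by simp⟩
    | succ i ih =>
      obtain ⟨C, K, hC, hsub, hle⟩ := ih
      obtain ⟨T, hT, hlt⟩ := exists_measureReal_diff_goodConvergentSet_le hμ hC k₀
      set n : ℕ → ℕ := fun M => M + extraDigits q 1 (Nat.log 2 M) + M
      refine ⟨C \ ⋃ M ∈ T, goodConvergentSet q M, K + ∑ M ∈ T, n M, ?_, ?_, ?_⟩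
      · refine (hC.mono (firstDigits_mono (by lia))).inter (DeterminedBy.compl ?_)
        intro a b hab ha
        obtain ⟨M, hM, haM⟩ := Set.mem_iUnion₂.1 ha
        refine Set.mem_iUnion₂.2 ⟨M, hM, determinedBy_goodConvergentSet M (fun p hp => ?_) haM⟩
        refine hab p (firstDigits_mono ?_ hp)
        have := Finset.single_le_sum (f := n) (fun _ _ => Nat.zero_le _) hM
        lia
      · refine fun a ha => ⟨hsub ha, fun h => ?_⟩
        obtain ⟨M, hM, haM⟩ := Set.mem_iUnion₂.1 h
        have hM0 := hT M hM
        exact ha (Nat.log 2 M) ((Nat.le_log_iff_pow_le one_lt_two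
          ((Nat.two_pow_pos k₀).trans_le hM0).ne').2 hM0) (goodConvergentSet_subset M haM)
      · rw [pow_succ']
        exact hlt.trans (by gcongr)
  rw [← measureReal_eq_zero_iff]
  refine le_antisymm (ge_of_tendsto' (tendsto_pow_atTop_nhds_zero_of_lt_one
    (by norm_num : (0 : ℝ) ≤ 5 / 6) (by norm_num)) fun i => ?_) measureReal_nonneg
  obtain ⟨C, K, -, hsub, hle⟩ := key i
  exact (measureReal_mono hsub).trans hle

end SingleSeries

section IndependentForms

open Polynomial

variable {q d : ℕ} [Fact q.Prime] {μ : Measure (Fin d → ℕ → ZMod q)} [IsFiniteMeasure μ]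

theorem measurableSet_vecPairing_eq_zero (v : Fin d → (ZMod q)[X]) :
    MeasurableSet {a : Fin d → ℕ → ZMod q | vecPairing a v = 0} := by
  have h : DeterminedBy (firstDigits d (∑ j, (v j).natDegree + 1))
      {a : Fin d → ℕ → ZMod q | vecPairing a v = 0} := fun a b hab ha => by
    rw [Set.mem_ofPred_eq, vecPairing_apply] at ha ⊢
    rw [← ha]
    refine Finset.sum_congr rfl fun j _ => ?_
    have hj := Finset.single_le_sum (f := fun j => (v j).natDegree) (fun _ _ => Nat.zero_le _)
      (Finset.mem_univ j)
    rw [digitPairing_eq_sum_range _ (Nat.lt_succ_of_le hj),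
      digitPairing_eq_sum_range _ (Nat.lt_succ_of_le hj)]
    refine Finset.sum_congr rfl fun l hl => ?_
    rw [hab (j, l) (mem_firstDigits.2 (Finset.mem_range.1 hl))]
  exact h.measurableSet

theorem measurableSet_digitsVanish (h : Fin d → (ZMod q)[X]) (r : ℕ) :
    MeasurableSet {a : Fin d → ℕ → ZMod q | DigitsVanish a h r} := by
  simp only [DigitsVanish, Set.ofPred_forall]
  exact MeasurableSet.iInter fun i => MeasurableSet.iInter fun _ =>
    measurableSet_vecPairing_eq_zero _

/-- Linearly independent linear forms in the digits vanish independently. -/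
theorem UniformDigits.measureReal_vecPairing_eq_zero (hμ : UniformDigits μ) {ι : Type*}
    [Fintype ι] {v : ι → Fin d → (ZMod q)[X]} (hv : LinearIndependent (ZMod q) v) :
    μ.real {a | ∀ i, vecPairing a (v i) = 0} = ((q : ℝ)⁻¹) ^ Fintype.card ι := by
  classical
  set n := ∑ i, ∑ j, (v i j).natDegree + 1
  have hn (i j) : (v i j).natDegree < n := by
    refine Nat.lt_succ_of_le ((Finset.single_le_sum (f := fun j => (v i j).natDegree)
      (fun _ _ => Nat.zero_le _) (Finset.mem_univ j)).trans ?_)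
    exact Finset.single_le_sum (f := fun i => ∑ j, (v i j).natDegree) (fun _ _ => Nat.zero_le _)
      (Finset.mem_univ i)
  set s := firstDigits d n
  let A : Matrix ι s (ZMod q) := fun i p => (v i p.1.1).coeff p.1.2
  have hset : {a : Fin d → ℕ → ZMod q | ∀ i, vecPairing a (v i) = 0}
      = restrictDigits s ⁻¹' (LinearMap.ker A.mulVecLin : Set (s → ZMod q)) := by
    ext a
    simp only [Set.mem_ofPred_eq, Set.mem_preimage, SetLike.mem_coe, LinearMap.mem_ker,
      Matrix.mulVecLin_apply, funext_iff, Pi.zero_apply]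
    refine forall_congr' fun i => ?_
    have : vecPairing a (v i) = (A.mulVec (restrictDigits s a)) i := by
      rw [vecPairing_apply, Finset.sum_congr rfl fun j _ => digitPairing_eq_sum_range _ (hn i j),
        ← Finset.sum_product', Matrix.mulVec, dotProduct]
      exact (Finset.sum_coe_sort s fun p => (v i p.1).coeff p.2 * a p.1 p.2).symm
    rw [this]
  have hA : LinearIndependent (ZMod q) A.row := by
    rw [Fintype.linearIndependent_iff] at hv ⊢
    refine fun g hg => hv g ?_
    funext j
    ext l
    by_cases hl : l < n
    · have := congrFun hg ⟨(j, l), mem_firstDigits.2 hl⟩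
      simpa [A, Matrix.row] using this
    · have h0 (i) : (v i j).coeff l = 0 :=
        coeff_eq_zero_of_natDegree_lt ((hn i j).trans_le (not_lt.1 hl))
      simp [h0]
  have hrank := hA.rank_matrix
  have hnull := LinearMap.finrank_range_add_finrank_ker A.mulVecLin
  rw [← Matrix.rank, hrank, Module.finrank_fintype_fun_eq_card, Fintype.card_coe] at hnull
  rw [hset, hμ.measureReal_restrictDigits_preimage]
  have hcard : Nat.card (LinearMap.ker A.mulVecLin : Set (s → ZMod q))
      = q ^ Module.finrank (ZMod q) (LinearMap.ker A.mulVecLin) := by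
    have := Module.natCard_eq_pow_finrank (K := ZMod q) (V := LinearMap.ker A.mulVecLin)
    rwa [Nat.card_zmod] at this
  have hq : (q : ℝ) ≠ 0 := by exact_mod_cast (Fact.out : q.Prime).ne_zero
  rw [hcard, ← hnull, pow_add, Nat.cast_pow, inv_pow _ (Module.finrank _ _)]
  field_simp

/-- The digits of linear forms whose coefficient vectors are linearly independent over the
polynomial ring vanish independently. -/
theorem UniformDigits.measureReal_digitsVanish (hμ : UniformDigits μ) {κ : Type*} [Fintype κ]
    {h : κ → Fin d → (ZMod q)[X]} (hh : LinearIndependent (ZMod q)[X] h) (r : κ → ℕ) :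
    μ.real {a | ∀ i, DigitsVanish a (h i) (r i)} = ((q : ℝ)⁻¹) ^ ∑ i, r i := by
  have hX : LinearIndependent (ZMod q) fun n : ℕ => (X ^ n : (ZMod q)[X]) := by
    simpa [← X_pow_eq_monomial] using (basisMonomials (ZMod q)).linearIndependent
  have hv := (linearIndependent_smul hX hh).comp
    (fun p : Σ i, Fin (r i) => ((p.2 : ℕ), p.1)) (by
      rintro ⟨i, x⟩ ⟨j, y⟩ hxy
      simp only [Prod.mk.injEq] at hxy
      obtain ⟨h1, rfl⟩ := hxy
      rw [Fin.ext h1])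
  have := hμ.measureReal_vecPairing_eq_zero hv
  rw [Fintype.card_sigma] at this
  simp only [Fintype.card_fin] at this
  rw [← this]
  congr 1
  ext a
  exact ⟨fun H p => H p.1 p.2 p.2.2, fun H i l hl => H ⟨i, ⟨l, hl⟩⟩⟩

theorem linearIndependent_pair_of_isCoprime {F : Type*} [Field F] {ι : Type*}
    {h h' : ι → F[X]} {j₀ j₁ : ι} (hm : ∀ j, (h j).Monic) (hm' : ∀ j, (h' j).Monic)
    (hc : IsCoprime (h j₀) (h j₁)) (hc' : IsCoprime (h' j₀) (h' j₁)) (hne : h ≠ h') :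
    LinearIndependent F[X] ![h, h'] := by
  refine LinearIndependent.pair_iff.2 fun s t hst => ?_
  have hj (j) : s * h j + t * h' j = 0 := congrFun hst j
  suffices hs : s = 0 by
    have := hj j₀
    rw [hs, zero_mul, zero_add] at this
    exact ⟨hs, (mul_eq_zero.1 this).resolve_right (hm' j₀).ne_zero⟩
  by_contra hs
  obtain ⟨u, w, huw⟩ := hc'
  obtain ⟨e, rfl⟩ : s ∣ t := ⟨-(u * h j₀ + w * h j₁), by
    linear_combination (-t) * huw + u * hj j₀ + w * hj j₁⟩
  have he (j) : h j = -e * h' j := mul_left_cancel₀ hs (by linear_combination hj j)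
  have hem : (-e).Monic := (hm' j₀).of_mul_monic_right (he j₀ ▸ hm j₀)
  have he1 : -e = 1 := hem.isUnit_iff.1 (hc.isUnit_of_dvd' ⟨_, he j₀⟩ ⟨_, he j₁⟩)
  exact hne (funext fun j => by rw [he j, he1, one_mul])

end IndependentForms

section CoprimeCount

open Polynomial

variable {F : Type*} [Field F]

theorem exists_monic_gcd {f g : F[X]} (hf : f ≠ 0) :
    ∃ D u w : F[X], D.Monic ∧ f = D * u ∧ g = D * w ∧ IsCoprime u w := by
  classical
  have hG : EuclideanDomain.gcd f g ≠ 0 := fun h => hf (EuclideanDomain.gcd_eq_zero_iff.1 h).1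
  set G := EuclideanDomain.gcd f g
  have hD := monic_mul_leadingCoeff_inv hG
  have hassoc : G * C G.leadingCoeff⁻¹ ∣ G := by
    refine ⟨C G.leadingCoeff, ?_⟩
    rw [mul_assoc, ← C_mul, inv_mul_cancel₀ (leadingCoeff_ne_zero.2 hG), C_1, mul_one]
  obtain ⟨u, hu⟩ := hassoc.trans (EuclideanDomain.gcd_dvd_left f g)
  obtain ⟨w, hw⟩ := hassoc.trans (EuclideanDomain.gcd_dvd_right f g)
  set D := G * C G.leadingCoeff⁻¹ with hDdef
  refine ⟨D, u, w, hD, hu, hw, EuclideanDomain.gcdA f g * C G.leadingCoeff⁻¹,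
    EuclideanDomain.gcdB f g * C G.leadingCoeff⁻¹, mul_left_cancel₀ hD.ne_zero ?_⟩
  have hab : G = f * _ + g * _ := EuclideanDomain.gcd_eq_gcd_ab f g
  linear_combination (-(EuclideanDomain.gcdA f g * C G.leadingCoeff⁻¹)) * hu
    - (EuclideanDomain.gcdB f g * C G.leadingCoeff⁻¹) * hw - C G.leadingCoeff⁻¹ * hab + hDdef

theorem eq_of_mul_eq_mul_of_isCoprime {D D' u u' w w' : F[X]} (hD : D.Monic) (hD' : D'.Monic)
    (hc : IsCoprime u w) (hc' : IsCoprime u' w') (hu : D * u = D' * u') (hw : D * w = D' * w') :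
    D = D' := by
  obtain ⟨x, y, hxy⟩ := hc
  obtain ⟨x', y', hxy'⟩ := hc'
  refine eq_of_monic_of_associated hD hD' (associated_of_dvd_dvd ?_ ?_)
  · exact ⟨x' * u + y' * w, by linear_combination (-D') * hxy' - x' * hu - y' * hw⟩
  · exact ⟨x * u' + y * w', by linear_combination (-D) * hxy + x * hu + y * hw⟩

theorem monic_divX {D : F[X]} (hD : D.Monic) (h0 : D.natDegree ≠ 0) : (divX D).Monic := by
  rw [Monic, leadingCoeff, natDegree_divX_eq_natDegree_tsub_one, coeff_divX,
    Nat.sub_add_cancel (Nat.one_le_iff_ne_zero.2 h0)]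
  exact hD

theorem monic_divX_mul {D u : F[X]} (hD : D.Monic) (hu : u.Monic) (h0 : D.natDegree ≠ 0) :
    (divX D * u).Monic ∧ (divX D * u).natDegree + 1 = (D * u).natDegree := by
  refine ⟨(monic_divX hD h0).mul hu, ?_⟩
  rw [(monic_divX hD h0).natDegree_mul hu, hD.natDegree_mul hu,
    natDegree_divX_eq_natDegree_tsub_one]
  lia

variable {ι : Type*}

/-- The vectors of monic polynomials with prescribed degrees. -/
def monicVectors (F : Type*) [Field F] (m : ι → ℕ) : Set (ι → F[X]) :=
  {h | ∀ j, (h j).Monic ∧ (h j).natDegree = m j}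

/-- The vectors of monic polynomials with prescribed degrees whose entries at two given places
are coprime. -/
def coprimeVectors (F : Type*) [Field F] (j₀ j₁ : ι) (m : ι → ℕ) : Set (ι → F[X]) :=
  {h ∈ monicVectors F m | IsCoprime (h j₀) (h j₁)}

/-- Vectors of monic polynomials with prescribed degrees correspond to vectors of lower
coefficients. -/
noncomputable def monicVectorsEquiv (F : Type*) [Field F] (m : ι → ℕ) :
    monicVectors F m ≃ ∀ j, Fin (m j) → F :=
  Equiv.subtypePiEquivPi.trans <| Equiv.piCongrRight fun j =>
    (monicEquivDegreeLT (m j)).trans (degreeLTEquiv F (m j)).toEquiv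

theorem finite_monicVectors [Finite ι] [Finite F] (m : ι → ℕ) : (monicVectors F m).Finite :=
  Finite.of_equiv _ (monicVectorsEquiv F m).symm

theorem ncard_monicVectors [Fintype ι] (m : ι → ℕ) :
    (monicVectors F m).ncard = Nat.card F ^ ∑ j, m j := by
  rw [← Nat.card_coe_set_eq, Nat.card_congr (monicVectorsEquiv F m), Nat.card_pi]
  simp [Nat.card_fun, Finset.prod_pow_eq_pow_sum]

variable [Fintype ι] [Finite F]

theorem ncard_monicVectors_sdiff_coprimeVectors_le {j₀ j₁ : ι} (hj : j₀ ≠ j₁) (m : ι → ℕ) :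
    Nat.card F * (monicVectors F m \ coprimeVectors F j₀ j₁ m).ncard
      ≤ (monicVectors F m).ncard := by
  classical
  have hex (h : ι → F[X]) : ∃ D u w : F[X], h j₀ ≠ 0 →
      D.Monic ∧ h j₀ = D * u ∧ h j₁ = D * w ∧ IsCoprime u w := by
    by_cases h0 : h j₀ = 0
    · exact ⟨0, 0, 0, fun h' => absurd h0 h'⟩
    · obtain ⟨D, u, w, H⟩ := exists_monic_gcd (g := h j₁) h0
      exact ⟨D, u, w, fun _ => H⟩
  choose D u w H using hex
  set S := monicVectors F m \ coprimeVectors F j₀ j₁ m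
  have hS (h) (hh : h ∈ S) : (D h).Monic ∧ h j₀ = D h * u h ∧ h j₁ = D h * w h ∧
      IsCoprime (u h) (w h) := H h (hh.1 j₀).1.ne_zero
  have hdeg (h) (hh : h ∈ S) : (D h).natDegree ≠ 0 := fun h0 => by
    obtain ⟨hD, hu, hw, hc⟩ := hS h hh
    rw [eq_one_of_monic_natDegree_zero hD h0, one_mul] at hu hw
    exact hh.2 ⟨hh.1, by rwa [hu, hw]⟩
  have hred (h) (hh : h ∈ S) :
      ((divX (D h) * u h).Monic ∧ (divX (D h) * u h).natDegree + 1 = m j₀) ∧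
      ((divX (D h) * w h).Monic ∧ (divX (D h) * w h).natDegree + 1 = m j₁) := by
    obtain ⟨hD, hu, hw, hc⟩ := hS h hh
    have h0 := hh.1 j₀
    have h1 := hh.1 j₁
    rw [hu] at h0
    rw [hw] at h1
    rw [← h0.2, ← h1.2]
    exact ⟨monic_divX_mul hD (hD.of_mul_monic_left h0.1) (hdeg h hh),
      monic_divX_mul hD (hD.of_mul_monic_left h1.1) (hdeg h hh)⟩
  let m' : ι → ℕ := fun j => if j = j₀ ∨ j = j₁ then m j - 1 else m j
  let φ : (ι → F[X]) → F × (ι → F[X]) := fun h => ((D h).coeff 0, fun j =>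
    if j = j₀ then divX (D h) * u h else if j = j₁ then divX (D h) * w h else h j)
  have hmaps : ∀ h ∈ S, φ h ∈ (Set.univ : Set F) ×ˢ monicVectors F m' := by
    refine fun h hh => ⟨trivial, fun j => ?_⟩
    obtain ⟨⟨h1, h2⟩, h3, h4⟩ := hred h hh
    simp only [φ, m']
    by_cases hj0 : j = j₀
    · subst hj0
      simp only [true_or, if_true]
      exact ⟨h1, by lia⟩
    · by_cases hj1 : j = j₁
      · subst hj1
        simp only [if_neg hj.symm, or_true, if_true]
        exact ⟨h3, by lia⟩
      · simp only [hj0, hj1, or_self, if_false]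
        exact hh.1 j
  have hinj : Set.InjOn φ S := by
    intro h hh h' hh' hφ
    obtain ⟨hD, hu, hw, hc⟩ := hS h hh
    obtain ⟨hD', hu', hw', hc'⟩ := hS h' hh'
    obtain ⟨hφ0, hφ1⟩ := Prod.mk.inj hφ
    have e0 := congrFun hφ1 j₀
    have e1 := congrFun hφ1 j₁
    simp only [if_true, if_neg hj.symm] at e0 e1
    have hX (g) (hg : g ∈ S) : (divX (D g)).Monic := monic_divX (hS g hg).1 (hdeg g hg)
    have hE : divX (D h) = divX (D h') :=
      eq_of_mul_eq_mul_of_isCoprime (hX h hh) (hX h' hh') hc hc' e0 e1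
    have hDD : D h = D h' := by
      rw [← divX_mul_X_add (D h), ← divX_mul_X_add (D h'), hE, hφ0]
    have hX0 := (hX h hh).ne_zero
    rw [← hE] at e0 e1
    funext j
    by_cases hj0 : j = j₀
    · rw [hj0, hu, hu', hDD, mul_left_cancel₀ hX0 e0]
    · by_cases hj1 : j = j₁
      · rw [hj1, hw, hw', hDD, mul_left_cancel₀ hX0 e1]
      · simpa [hj0, hj1] using congrFun hφ1 j
  have hle := Set.ncard_le_ncard_of_injOn φ hmaps hinj
    (Set.finite_univ.prod (finite_monicVectors m'))
  rw [Set.ncard_prod, Set.ncard_univ, ncard_monicVectors] at hle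
  rcases S.eq_empty_or_nonempty with hS0 | ⟨h, hh⟩
  · rw [hS0, Set.ncard_empty, mul_zero]
    exact Nat.zero_le _
  have hpos := hred h hh
  have hsum : ∑ j, m j = ∑ j, m' j + 2 := by
    have h1 (j) : m j = m' j + if j ∈ ({j₀, j₁} : Finset ι) then 1 else 0 := by
      simp only [m', Finset.mem_insert, Finset.mem_singleton]
      by_cases hj0 : j = j₀
      · subst hj0
        simp only [true_or, if_true]
        lia
      · by_cases hj1 : j = j₁
        · subst hj1
          simp only [or_true, if_true]
          lia
        · simp [hj0, hj1]
    conv_lhs => rw [Finset.sum_congr rfl fun j _ => h1 j, Finset.sum_add_distrib,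
      Finset.sum_ite_mem, Finset.univ_inter, Finset.sum_const, Finset.card_pair hj,
      smul_eq_mul, mul_one]
  rw [ncard_monicVectors, hsum]
  calc Nat.card F * S.ncard ≤ Nat.card F * (Nat.card F * Nat.card F ^ ∑ j, m' j) := by gcongr
    _ = _ := by ring

theorem card_pow_le_two_mul_ncard_coprimeVectors {j₀ j₁ : ι} (hj : j₀ ≠ j₁) (m : ι → ℕ) :
    Nat.card F ^ ∑ j, m j ≤ 2 * (coprimeVectors F j₀ j₁ m).ncard := by
  have h1 := ncard_monicVectors_sdiff_coprimeVectors_le (F := F) hj m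
  have h2 := Set.ncard_sdiff_add_ncard_of_subset
    (show coprimeVectors F j₀ j₁ m ⊆ monicVectors F m from fun _ h => h.1) (finite_monicVectors m)
  have h3 : 2 ≤ Nat.card F := Finite.one_lt_card
  rw [← ncard_monicVectors]
  nlinarith

end CoprimeCount

section SeveralSeries

open Polynomial

theorem div_one_add_le_measureReal_biUnion {Ω ι : Type*} [MeasurableSpace Ω] {μ : Measure Ω}
    [IsFiniteMeasure μ] (I : Finset ι) (E : ι → Set Ω) (hE : ∀ i ∈ I, MeasurableSet (E i))
    (h : ∀ i ∈ I, ∀ j ∈ I, i ≠ j → μ.real (E i ∩ E j) = μ.real (E i) * μ.real (E j)) :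
    (∑ i ∈ I, μ.real (E i)) / (1 + ∑ i ∈ I, μ.real (E i)) ≤ μ.real (⋃ i ∈ I, E i) := by
  classical
  have h0 : 0 ≤ ∑ i ∈ I, μ.real (E i) := Finset.sum_nonneg fun _ _ => measureReal_nonneg
  refine sum_div_le_measureReal_biUnion μ I E hE (by linarith) ?_
  have hpair (i) (hi : i ∈ I) (j) (hj : j ∈ I) : μ.real (E i ∩ E j)
      ≤ (if i = j then μ.real (E i) else 0) + μ.real (E i) * μ.real (E j) := by
    by_cases hij : i = j
    · subst hij
      rw [if_pos rfl, Set.inter_self]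
      have := mul_self_nonneg (μ.real (E i))
      linarith
    · rw [if_neg hij, zero_add, h i hi j hj hij]
  refine (Finset.sum_le_sum fun i hi => Finset.sum_le_sum fun j hj => hpair i hi j hj).trans ?_
  simp only [Finset.sum_add_distrib, ← Finset.mul_sum, ← Finset.sum_mul, Finset.sum_ite_eq,
    Finset.sum_ite_mem, Finset.inter_self]
  exact le_of_eq (by ring)

variable {q d : ℕ} [Fact q.Prime]

/-- The number of vanishing digits required from the linear form with coefficient vector `h`. -/
noncomputable def requiredDigits (j₀ : Fin d) (h : Fin d → (ZMod q)[X]) : ℕ :=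
  ∑ j, (h j).natDegree + extraDigits q d (Nat.log 2 (h j₀).natDegree)

open Classical in
/-- The vectors of monic polynomials with coprime entries at two places, all of whose degrees lie
in `[2 ^ k, 2 ^ (k + 1))`. -/
noncomputable def dyadicVectors (q k : ℕ) [Fact q.Prime] (j₀ j₁ : Fin d) :
    Finset (Fin d → (ZMod q)[X]) :=
  (Fintype.piFinset fun _ : Fin d => Finset.Ico (2 ^ k) (2 ^ (k + 1))).biUnion fun m =>
    ((finite_monicVectors (F := ZMod q) m).subset
      (fun _ h => h.1 : coprimeVectors (ZMod q) j₀ j₁ m ⊆ _)).toFinset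

theorem mem_dyadicVectors {k : ℕ} {j₀ j₁ : Fin d} {h : Fin d → (ZMod q)[X]} :
    h ∈ dyadicVectors q k j₀ j₁ ↔ (∀ j, (h j).Monic ∧ 2 ^ k ≤ (h j).natDegree ∧
      (h j).natDegree < 2 ^ (k + 1)) ∧ IsCoprime (h j₀) (h j₁) := by
  simp only [dyadicVectors, Finset.mem_biUnion, Fintype.mem_piFinset, Finset.mem_Ico,
    Set.Finite.mem_toFinset, coprimeVectors, monicVectors, Set.mem_ofPred_eq]
  constructor
  · rintro ⟨m, hm, hh, hc⟩
    exact ⟨fun j => ⟨(hh j).1, (hh j).2 ▸ hm j⟩, hc⟩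
  · rintro ⟨hh, hc⟩
    exact ⟨fun j => (h j).natDegree, fun j => (hh j).2, fun j => ⟨(hh j).1, rfl⟩, hc⟩

theorem log_natDegree_of_mem_dyadicVectors {k : ℕ} {j₀ j₁ : Fin d} {h : Fin d → (ZMod q)[X]}
    (hh : h ∈ dyadicVectors q k j₀ j₁) : Nat.log 2 (h j₀).natDegree = k :=
  let H := ((mem_dyadicVectors.1 hh).1 j₀).2
  Nat.log_eq_of_pow_le_of_lt_pow H.1 H.2

theorem inv_le_sum_dyadicVectors {k : ℕ} (hk : 1 ≤ k) {j₀ j₁ : Fin d} (hj : j₀ ≠ j₁) :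
    (2 * (q : ℝ) * k)⁻¹
      ≤ ∑ h ∈ dyadicVectors q k j₀ j₁, ((q : ℝ)⁻¹) ^ requiredDigits j₀ h := by
  classical
  have hq1 : 1 < q := (Fact.out : q.Prime).one_lt
  have hq0 : (0 : ℝ) < q := by exact_mod_cast zero_lt_one.trans hq1
  have hd : 1 ≤ d := j₀.pos
  rw [Finset.sum_congr rfl fun h hh => by
    rw [requiredDigits, log_natDegree_of_mem_dyadicVectors hh], dyadicVectors, Finset.sum_biUnion]
  · have hterm (m : Fin d → ℕ) :
        1 / 2 * ((q : ℝ)⁻¹) ^ extraDigits q d k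
          ≤ ∑ h ∈ ((finite_monicVectors (F := ZMod q) m).subset
            (fun _ h => h.1 : coprimeVectors (ZMod q) j₀ j₁ m ⊆ _)).toFinset,
              ((q : ℝ)⁻¹) ^ (∑ j, (h j).natDegree + extraDigits q d k) := by
      rw [Finset.sum_congr rfl fun h hh => by
        rw [Finset.sum_congr rfl fun j _ => (((Set.Finite.mem_toFinset _).1 hh).1 j).2],
        Finset.sum_const, ← Set.ncard_eq_toFinset_card _ (Set.Finite.subset (finite_monicVectors m) fun _ h => h.1),
        nsmul_eq_mul, pow_add, ← mul_assoc]
      gcongr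
      have h := card_pow_le_two_mul_ncard_coprimeVectors (F := ZMod q) hj m
      rw [Nat.card_zmod] at h
      have h' : (q : ℝ) ^ ∑ j, m j ≤ 2 * (coprimeVectors (ZMod q) j₀ j₁ m).ncard := by
        exact_mod_cast h
      rw [inv_pow, ← div_eq_mul_inv, le_div_iff₀ (by positivity)]
      linarith
    refine le_trans ?_ (Finset.sum_le_sum fun m _ => hterm m)
    have h := inv_le_two_pow_mul_inv_pow_extraDigits hq1 hd hk
    rw [Finset.sum_const, nsmul_eq_mul, Fintype.card_piFinset]
    simp only [Nat.card_Ico, Finset.prod_const, Finset.card_univ, Fintype.card_fin]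
    rw [show 2 ^ (k + 1) - 2 ^ k = 2 ^ k by rw [pow_succ]; lia, ← pow_mul]
    push_cast
    rw [mul_assoc, mul_inv]
    linarith
  · intro m _ m' _ hne
    refine Finset.disjoint_left.2 fun h hh hh' => hne (funext fun j => ?_)
    rw [Set.Finite.mem_toFinset] at hh hh'
    rw [← (hh.1 j).2, (hh'.1 j).2]

theorem measure_forall_notMem_exceptionalSet_of_ne {μ : Measure (Fin d → ℕ → ZMod q)}
    [IsProbabilityMeasure μ] (hμ : UniformDigits μ) {j₀ j₁ : Fin d} (hj : j₀ ≠ j₁) (k₀ : ℕ) :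
    μ {a | ∀ k ≥ k₀, a ∉ exceptionalSet q d k} = 0 := by
  classical
  have hq0 : (0 : ℝ) < q := by exact_mod_cast (Fact.out : q.Prime).pos
  set Bad := {a : Fin d → ℕ → ZMod q | ∀ k ≥ k₀, a ∉ exceptionalSet q d k}
  rw [← measureReal_eq_zero_iff]
  by_contra hne
  have hpos : 0 < μ.real Bad := lt_of_le_of_ne measureReal_nonneg (Ne.symm hne)
  obtain ⟨K, hK⟩ := exists_lt_sum_Ico_inv (2 * q * (μ.real Bad)⁻¹) (max k₀ 1)
  set I := (Finset.Ico (max k₀ 1) K).biUnion fun k => dyadicVectors q k j₀ j₁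
  set E : (Fin d → (ZMod q)[X]) → Set (Fin d → ℕ → ZMod q) :=
    fun h => {a | DigitsVanish a h (requiredDigits j₀ h)}
  have hI (h) (hh : h ∈ I) : ∃ k, k₀ ≤ k ∧ h ∈ dyadicVectors q k j₀ j₁ := by
    obtain ⟨k, hk, hh⟩ := Finset.mem_biUnion.1 hh
    exact ⟨k, (le_max_left _ _).trans (Finset.mem_Ico.1 hk).1, hh⟩
  have hmonic (h) (hh : h ∈ I) (j) : (h j).Monic := by
    obtain ⟨k, -, hh⟩ := hI h hh
    exact ((mem_dyadicVectors.1 hh).1 j).1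
  have hcop (h) (hh : h ∈ I) : IsCoprime (h j₀) (h j₁) := by
    obtain ⟨k, -, hh⟩ := hI h hh
    exact (mem_dyadicVectors.1 hh).2
  have hsingle (h) (hh : h ∈ I) : μ.real (E h) = ((q : ℝ)⁻¹) ^ requiredDigits j₀ h := by
    have hli : LinearIndependent (ZMod q)[X] fun _ : Unit => h :=
      linearIndependent_unique_iff.2 fun h0 => (hmonic h hh j₀).ne_zero (congrFun h0 j₀)
    simpa using hμ.measureReal_digitsVanish hli fun _ => requiredDigits j₀ h
  have hpair (h) (hh : h ∈ I) (h') (hh' : h' ∈ I) (hne : h ≠ h') :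
      μ.real (E h ∩ E h') = μ.real (E h) * μ.real (E h') := by
    have := hμ.measureReal_digitsVanish (linearIndependent_pair_of_isCoprime (hmonic h hh)
      (hmonic h' hh') (hcop h hh) (hcop h' hh') hne) ![requiredDigits j₀ h, requiredDigits j₀ h']
    rw [Fin.sum_univ_two] at this
    simp only [Fin.forall_fin_two, Matrix.cons_val_zero, Matrix.cons_val_one] at this
    rw [hsingle h hh, hsingle h' hh', ← pow_add, ← this]
    rfl
  have hE (h) (_ : h ∈ I) : MeasurableSet (E h) := measurableSet_digitsVanish _ _
  have hU := div_one_add_le_measureReal_biUnion I E hE hpair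
  set σ := ∑ h ∈ I, μ.real (E h) with hσ
  have hσ_lt : (μ.real Bad)⁻¹ < σ := by
    rw [hσ, Finset.sum_congr rfl hsingle, Finset.sum_biUnion]
    · calc (μ.real Bad)⁻¹ = (2 * (q : ℝ))⁻¹ * (2 * q * (μ.real Bad)⁻¹) := by field_simp
        _ < (2 * (q : ℝ))⁻¹ * ∑ k ∈ Finset.Ico (max k₀ 1) K, ((k : ℝ))⁻¹ := by gcongr
        _ = ∑ k ∈ Finset.Ico (max k₀ 1) K, (2 * (q : ℝ) * k)⁻¹ := by
          rw [Finset.mul_sum]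
          exact Finset.sum_congr rfl fun k _ => (mul_inv _ _).symm
        _ ≤ _ := Finset.sum_le_sum fun k hk =>
          inv_le_sum_dyadicVectors ((le_max_right _ _).trans (Finset.mem_Ico.1 hk).1) hj
    · intro k _ k' _ hne
      exact Finset.disjoint_left.2 fun h hh hh' => hne
        ((log_natDegree_of_mem_dyadicVectors hh).symm.trans
          (log_natDegree_of_mem_dyadicVectors hh'))
  have hsub : Bad ⊆ (⋃ h ∈ I, E h)ᶜ := by
    intro a ha hmem
    obtain ⟨h, hh, hah⟩ := Set.mem_iUnion₂.1 hmem
    obtain ⟨k, hk, hhk⟩ := hI h hh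
    refine ha k hk ⟨h, fun j => ⟨hmonic h hh j, ((mem_dyadicVectors.1 hhk).1 j).2.2⟩, ?_⟩
    have : DigitsVanish a h (requiredDigits j₀ h) := hah
    rwa [requiredDigits, log_natDegree_of_mem_dyadicVectors hhk] at this
  have hle : μ.real Bad ≤ 1 - σ / (1 + σ) := by
    refine (measureReal_mono hsub).trans ?_
    rw [probReal_compl_eq_one_sub (Finset.measurableSet_biUnion I hE)]
    linarith
  have hσ0 : 0 < σ := (inv_pos.2 hpos).trans hσ_lt
  have h1 : 1 < σ * μ.real Bad := by
    rwa [inv_lt_iff_one_lt_mul₀ hpos] at hσ_lt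
  have h2 : 1 - σ / (1 + σ) = 1 / (1 + σ) := by field_simp; ring
  rw [h2, le_div_iff₀ (by linarith)] at hle
  linarith

end SeveralSeries

theorem measure_forall_notMem_exceptionalSet {q d : ℕ} [Fact q.Prime] (hd : 1 ≤ d)
    {μ : Measure (Fin d → ℕ → ZMod q)} [IsProbabilityMeasure μ] (hμ : UniformDigits μ) (k₀ : ℕ) :
    μ {a | ∀ k ≥ k₀, a ∉ exceptionalSet q d k} = 0 := by
  rcases hd.eq_or_lt with rfl | hd
  · exact measure_forall_notMem_exceptionalSet_one hμ k₀
  · exact measure_forall_notMem_exceptionalSet_of_ne hμ (j₀ := ⟨0, by lia⟩) (j₁ := ⟨1, hd⟩)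
      (by simp) k₀

theorem stmt5 (d : ℕ) (hd : 1 ≤ d) (q : ℕ) (hq : q.Prime)
    (μ : Measure (Fin d → ℕ → ZMod q)) [IsProbabilityMeasure μ]
    (hμ : ∀ (s : Finset (Fin d × ℕ)) (v : Fin d × ℕ → ZMod q),
      μ {a | ∀ p ∈ s, a p.1 p.2 = v p} = ((q : ENNReal))⁻¹ ^ s.card) :
    ∃ c > 0, ∀ᵐ a ∂μ, ∀ m : ℕ, ∃ N : ℕ, m ≤ N ∧
      c * Real.log N ^ d * Real.log (Real.log N) / N
        ≤ starDisc (digitalKronecker d a) N := by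
  have : Fact q.Prime := ⟨hq⟩
  obtain ⟨c, hc, H⟩ := exists_le_starDisc_of_mem_exceptionalSet hq.one_lt hd
  refine ⟨c, hc, ae_all_iff.2 fun m => ?_⟩
  refine measure_mono_null (t := {a | ∀ k ≥ max m 1, a ∉ exceptionalSet q d k})
    (fun a ha k hk hak => ha ?_) (measure_forall_notMem_exceptionalSet hd hμ _)
  obtain ⟨N, hN, hle⟩ := H a k ((le_max_right _ _).trans hk) hak
  exact ⟨N, ((le_max_left _ _).trans hk).trans hN, hle⟩
end

section
/- Let d ≥ 1 and let q be a prime. There is a constant c(d,q) > 0 depending only on d and q such that for every t ∈ ℕ with t ≥ 2 there exist polynomials g_1,…,g_d ∈ Z_q[x] with g_1 = 1 and gcd(g_i, x) = 1 for i = 1,…,d, such that the point set x_n := ({n(x)g_1(x)/x^t}|_{x=q}, …, {n(x)g_d(x)/x^t}|_{x=q}), n = 0,…,q^t − 1, with N := q^t points has star discrepancy D_N* < c(d,q) · (log N)^{d−1} (log log N) / N. -/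
open Real

/-- The polynomial `n(x) = n₀ + n₁x + ⋯ ∈ (ZMod q)[x]` associated with the
base-`q` digit expansion `n = n₀ + n₁q + ⋯` of a nonnegative integer `n`. -/
noncomputable def natPoly (q n : ℕ) : Polynomial (ZMod q) :=
  ∑ i ∈ Finset.range (Nat.digits q n).length,
    Polynomial.C ((Nat.digits q n).getD i 0 : ZMod q) * Polynomial.X ^ i

/-- The point set `x_n = ({n(x)g_1(x)/x^t}|_{x=q}, …, {n(x)g_d(x)/x^t}|_{x=q})`:
the coefficient of `x^{-(k+1)}` in `n(x)·g_j(x)/x^t` is the coefficient of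
`x^{t-1-k}` in the polynomial `n(x)·g_j(x)`. -/
noncomputable def ratNet {q : ℕ} (d t : ℕ) (g : Fin d → Polynomial (ZMod q))
    (n : ℕ) : Fin d → ℝ :=
  fun j => ∑ k ∈ Finset.range t,
    (((natPoly q n * g j).coeff (t - 1 - k)).val : ℝ) / (q : ℝ) ^ (k + 1)

open Polynomial

/-- The integer with base-`q` digits `w 0, …, w (b - 1)`. -/
def digitSum {q : ℕ} (w : ℕ → ZMod q) (b : ℕ) : ℕ :=
  ∑ m ∈ Finset.range b, (w m).val * q ^ m

lemma digitSum_succ {q : ℕ} (w : ℕ → ZMod q) (b : ℕ) :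
    digitSum w (b + 1) = digitSum w b + (w b).val * q ^ b :=
  Finset.sum_range_succ _ _

lemma digitSum_lt {q : ℕ} [NeZero q] (w : ℕ → ZMod q) (b : ℕ) : digitSum w b < q ^ b := by
  induction b with
  | zero => simp [digitSum]
  | succ b ih =>
    rw [digitSum_succ, pow_succ']
    have h := Nat.mul_le_mul_right (q ^ b) (Nat.succ_le_of_lt (ZMod.val_lt (w b)))
    rw [Nat.succ_mul] at h
    omega

lemma digitSum_add {q : ℕ} (w : ℕ → ZMod q) (a b : ℕ) :
    digitSum w (a + b) = digitSum w a + q ^ a * digitSum (fun m => w (a + m)) b := by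
  unfold digitSum
  rw [Finset.sum_range_add, Finset.mul_sum]
  congr 1
  exact Finset.sum_congr rfl fun m _ => by rw [pow_add]; ring

lemma digitSum_div {q : ℕ} [NeZero q] (w : ℕ → ZMod q) (a b : ℕ) :
    digitSum w (a + b) / q ^ a = digitSum (fun m => w (a + m)) b := by
  have hq : 0 < q ^ a := pow_pos (NeZero.pos q) a
  rw [digitSum_add, Nat.add_mul_div_left _ _ hq, Nat.div_eq_of_lt (digitSum_lt w a), zero_add]

lemma digitSum_inj {q : ℕ} [NeZero q] {w w' : ℕ → ZMod q} {b : ℕ} :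
    digitSum w b = digitSum w' b ↔ ∀ m < b, w m = w' m := by
  constructor
  · induction b with
    | zero => intro _ m hm; omega
    | succ b ih =>
      intro h m hm
      rw [digitSum_succ, digitSum_succ] at h
      have h1 := digitSum_lt w b
      have h2 := digitSum_lt w' b
      have hmod := congrArg (· % q ^ b) h
      simp only [Nat.add_mul_mod_self_right, Nat.mod_eq_of_lt h1, Nat.mod_eq_of_lt h2] at hmod
      rcases Nat.lt_succ_iff_lt_or_eq.mp hm with hm | rfl
      · exact ih hmod m hm
      · rw [hmod] at h
        have := Nat.eq_of_mul_eq_mul_right (pow_pos (NeZero.pos q) m) (Nat.add_left_cancel h)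
        exact ZMod.val_injective q this
  · intro h
    exact Finset.sum_congr rfl fun m hm => by rw [h m (Finset.mem_range.mp hm)]

lemma digitSum_digits {q : ℕ} [NeZero q] (e b : ℕ) :
    digitSum (fun m => ((e / q ^ m % q : ℕ) : ZMod q)) b = e % q ^ b := by
  induction b with
  | zero => simp [digitSum, Nat.mod_one]
  | succ b ih =>
    rw [digitSum_succ, ih, Nat.mod_pow_succ, ZMod.val_natCast, Nat.mod_mod, mul_comm (q ^ b)]

lemma coeff_natPoly {q : ℕ} (hq : 2 ≤ q) (n m : ℕ) :
    (natPoly q n).coeff m = ((n / q ^ m % q : ℕ) : ZMod q) := by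
  simp only [natPoly, finsetSum_coeff, coeff_C_mul, coeff_X_pow, mul_ite, mul_one, mul_zero,
    Finset.sum_ite_eq, Finset.mem_range]
  rw [← Nat.getD_digits n m hq]
  split_ifs with h
  · rfl
  · rw [List.getD_eq_default _ _ (not_lt.mp h), Nat.cast_zero]

/-- The polynomials over `ZMod q` of degree less than `t`. -/
abbrev PolyLT (q t : ℕ) : Type := degreeLT (ZMod q) t

instance {q t : ℕ} [NeZero q] : Finite (PolyLT q t) :=
  Finite.of_equiv _ (degreeLTEquiv (ZMod q) t).symm.toEquiv

lemma card_polyLT (q t : ℕ) [NeZero q] : Nat.card (PolyLT q t) = q ^ t := by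
  rw [Nat.card_congr (degreeLTEquiv (ZMod q) t).toEquiv]
  simp

lemma PolyLT.coeff_eq_zero {q t : ℕ} (n : PolyLT q t) {m : ℕ} (hm : t ≤ m) :
    (n : (ZMod q)[X]).coeff m = 0 :=
  (degree_lt_iff_coeff_zero _ _).mp (mem_degreeLT.mp n.2) m hm

lemma mem_degreeLT_of_coeff {q t : ℕ} {p : (ZMod q)[X]} (h : ∀ m, t ≤ m → p.coeff m = 0) :
    p ∈ degreeLT (ZMod q) t :=
  mem_degreeLT.mpr ((degree_lt_iff_coeff_zero _ _).mpr h)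

/-- The correspondence between integers below `q ^ t` and polynomials of degree less than `t`. -/
noncomputable def natPolyEquiv (q t : ℕ) [NeZero q] (hq : 2 ≤ q) :
    {n : ℕ // n < q ^ t} ≃ PolyLT q t where
  toFun n := ⟨natPoly q n, mem_degreeLT_of_coeff fun m hm => by
    rw [coeff_natPoly hq, Nat.div_eq_of_lt (n.2.trans_le (Nat.pow_le_pow_right (by omega) hm))]
    simp⟩
  invFun p := ⟨digitSum (p : (ZMod q)[X]).coeff t, digitSum_lt _ _⟩
  left_inv n := by
    ext
    simp only [funext (coeff_natPoly hq n.1)]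
    rw [digitSum_digits, Nat.mod_eq_of_lt n.2]
  right_inv p := by
    ext m
    simp only
    rcases lt_or_ge m t with hm | hm
    · have h := digitSum_digits (q := q) (digitSum (p : (ZMod q)[X]).coeff t) t
      rw [Nat.mod_eq_of_lt (digitSum_lt _ _), digitSum_inj] at h
      rw [coeff_natPoly hq, h m hm]
    · rw [p.coeff_eq_zero hm, coeff_natPoly hq,
        Nat.div_eq_of_lt ((digitSum_lt _ _).trans_le (Nat.pow_le_pow_right (by omega) hm))]
      simp

lemma ratNet_eq {q : ℕ} [NeZero q] (d t : ℕ) (g : Fin d → (ZMod q)[X]) (n : ℕ) (i : Fin d) :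
    ratNet d t g n i = (digitSum (natPoly q n * g i).coeff t : ℝ) / (q : ℝ) ^ t := by
  have hq : (q : ℝ) ≠ 0 := Nat.cast_ne_zero.mpr (NeZero.ne q)
  unfold ratNet digitSum
  rw [← Finset.sum_range_reflect (fun m => ((natPoly q n * g i).coeff m).val * q ^ m)]
  push_cast
  rw [Finset.sum_div]
  refine Finset.sum_congr rfl fun k hk => ?_
  have hk := Finset.mem_range.mp hk
  rw [div_eq_div_iff (pow_ne_zero _ hq) (pow_ne_zero _ hq), mul_assoc, ← pow_add]
  congr 2
  omega

lemma card_fiber_eq_zero_or {G H : Type*} [AddCommGroup G] [AddCommGroup H] (f : G →+ H) (y : H) :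
    Nat.card {x // f x = y} = 0 ∨ Nat.card {x // f x = y} = Nat.card {x // f x = 0} := by
  by_cases h : ∃ x₀, f x₀ = y
  · obtain ⟨x₀, rfl⟩ := h
    right
    refine Nat.card_congr ⟨fun x => ⟨x.1 - x₀, ?_⟩, fun x => ⟨x.1 + x₀, ?_⟩, ?_, ?_⟩
    · rw [map_sub, x.2, sub_self]
    · rw [map_add, x.2, zero_add]
    · intro x; simp
    · intro x; simp
  · left
    have : IsEmpty {x // f x = y} := ⟨fun x => h ⟨x.1, x.2⟩⟩
    exact Nat.card_of_isEmpty

/-- For a homomorphism between finite groups of order `q ^ t` and `q ^ s`, either all fibres have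
the expected size, or the kernel is at least twice as large as expected. -/
lemma card_fiber_dichotomy {q s t : ℕ} (hq : q.Prime) {G H : Type*} [AddCommGroup G]
    [AddCommGroup H] [Finite H] (hG : Nat.card G = q ^ t) (hH : Nat.card H = q ^ s)
    (hst : s ≤ t) (f : G →+ H) :
    (∀ y, Nat.card {x // f x = y} = q ^ (t - s)) ∨
      2 * q ^ (t - s) ≤ Nat.card {x // f x = 0} := by
  have hK : Nat.card {x // f x = 0} * Nat.card f.range = q ^ t := by
    rw [← hG, ← f.ker.card_mul_index, AddSubgroup.index_ker]
    rfl
  obtain ⟨u, hu, hR⟩ := (Nat.dvd_prime_pow hq).mp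
    (hH ▸ AddSubgroup.card_addSubgroup_dvd_card f.range)
  rw [hR] at hK
  have hpos : ∀ n, 0 < q ^ n := fun n => pow_pos hq.pos n
  have hK' : Nat.card {x // f x = 0} = q ^ (t - u) := by
    apply Nat.eq_of_mul_eq_mul_right (hpos u)
    rw [hK, ← pow_add]
    congr 1
    omega
  rcases hu.lt_or_eq with hu | rfl
  · right
    rw [hK', show t - u = (t - s) + (s - u - 1) + 1 by omega, pow_succ, mul_comm, pow_add]
    exact Nat.mul_le_mul (Nat.le_mul_of_pos_right _ (hpos _)) hq.two_le
  · left
    intro y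
    have htop : f.range = ⊤ := (AddSubgroup.card_eq_iff_eq_top _).mp (hR.trans hH.symm)
    obtain ⟨x₀, hx₀⟩ : y ∈ f.range := htop ▸ AddSubgroup.mem_top y
    rcases card_fiber_eq_zero_or f y with h | h
    · have hfin : Finite G := Nat.finite_of_card_ne_zero (hG ▸ (hpos t).ne')
      exact ((Finite.card_eq_zero_iff.mp h).false ⟨x₀, hx₀⟩).elim
    · rw [h, hK']

/-- Number of points minus expected number of points of the integer box `∏ [lo i, hi i)` inside
`[0, N)^d`. -/
noncomputable def boxDisc {V : Type*} {d : ℕ} (N : ℝ) (y : V → Fin d → ℕ) (lo hi : Fin d → ℕ) : ℝ :=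
  Nat.card {n : V // ∀ i, lo i ≤ y n i ∧ y n i < hi i} - N * ∏ i, ((hi i : ℝ) - lo i) / N

/-- The coordinates, scaled by `q ^ t`, of the point belonging to the polynomial `n`. -/
noncomputable def netCoord {q d t : ℕ} (g : Fin d → (ZMod q)[X]) (n : PolyLT q t) (i : Fin d) : ℕ :=
  digitSum ((n : (ZMod q)[X]) * g i).coeff t

/-- The number of points all of whose leading `k i` digits vanish. -/
noncomputable def zeroCount {q d : ℕ} (t : ℕ) (g : Fin d → (ZMod q)[X]) (k : Fin d → ℕ) : ℕ :=
  Nat.card {n : PolyLT q t // ∀ i, ∀ j < k i,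
    ((n : (ZMod q)[X]) * g i).coeff (t - k i + j) = 0}

/-- The excess number of points in the elementary box of order `k` at the origin. -/
noncomputable def excess {q d : ℕ} (t : ℕ) (g : Fin d → (ZMod q)[X]) (k : Fin d → ℕ) : ℝ :=
  zeroCount t g k - (q : ℝ) ^ (t - ∑ i, k i)

/-- The leading `k i` digits of the `i`-th coordinates, as an additive map. -/
noncomputable def leadingDigits {q d : ℕ} (t : ℕ) (g : Fin d → (ZMod q)[X]) (k : Fin d → ℕ) :
    PolyLT q t →+ ((x : Σ i, Fin (k i)) → ZMod q) where
  toFun n x := ((n : (ZMod q)[X]) * g x.1).coeff (t - k x.1 + x.2)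
  map_zero' := by ext; simp
  map_add' n n' := by ext; simp [add_mul]

lemma leadingDigits_eq_iff {q d t : ℕ} {g : Fin d → (ZMod q)[X]} {k : Fin d → ℕ}
    {c : Fin d → ℕ → ZMod q} {n : PolyLT q t} :
    leadingDigits t g k n = (fun x => c x.1 x.2) ↔
      ∀ i, ∀ j < k i, ((n : (ZMod q)[X]) * g i).coeff (t - k i + j) = c i j :=
  ⟨fun h i j hj => congrFun h ⟨i, j, hj⟩, fun h => funext fun x => h x.1 x.2 x.2.2⟩

lemma zeroCount_eq {q d t : ℕ} (g : Fin d → (ZMod q)[X]) (k : Fin d → ℕ) :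
    zeroCount t g k = Nat.card {n : PolyLT q t // leadingDigits t g k n = 0} :=
  Nat.card_congr (Equiv.subtypeEquivRight fun _ =>
    (leadingDigits_eq_iff (c := fun _ _ => 0)).symm)

lemma mem_block_iff {q d t : ℕ} [NeZero q] (g : Fin d → (ZMod q)[X]) {k e : Fin d → ℕ}
    (hk : ∀ i, k i ≤ t) (he : ∀ i, e i < q ^ k i) (n : PolyLT q t) :
    (∀ i, e i * q ^ (t - k i) ≤ netCoord g n i ∧ netCoord g n i < (e i + 1) * q ^ (t - k i)) ↔
      leadingDigits t g k n = fun x => ((e x.1 / q ^ (x.2 : ℕ) % q : ℕ) : ZMod q) := by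
  rw [leadingDigits_eq_iff (c := fun i j => ((e i / q ^ j % q : ℕ) : ZMod q))]
  refine forall_congr' fun i => ?_
  rw [← digitSum_inj (w := fun j => ((n : (ZMod q)[X]) * g i).coeff (t - k i + j))
    (w' := fun j => ((e i / q ^ j % q : ℕ) : ZMod q)), digitSum_digits, Nat.mod_eq_of_lt (he i),
    ← digitSum_div, Nat.sub_add_cancel (hk i), Nat.div_eq_iff (pow_pos (NeZero.pos q) _)]
  have := pow_pos (NeZero.pos q) (t - k i)
  unfold netCoord
  rw [Nat.succ_mul]
  omega

lemma excess_dichotomy {q d t : ℕ} (hq : q.Prime) (g : Fin d → (ZMod q)[X]) {k : Fin d → ℕ}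
    (hk : ∑ i, k i ≤ t) :
    (∀ y, Nat.card {n // leadingDigits t g k n = y} = q ^ (t - ∑ i, k i)) ∨
      2 * q ^ (t - ∑ i, k i) ≤ zeroCount t g k := by
  have : NeZero q := ⟨hq.ne_zero⟩
  rw [zeroCount_eq]
  refine card_fiber_dichotomy hq (card_polyLT q t) ?_ hk _
  simp

lemma excess_nonneg {q d t : ℕ} (hq : q.Prime) (g : Fin d → (ZMod q)[X]) {k : Fin d → ℕ}
    (hk : ∑ i, k i ≤ t) : 0 ≤ excess t g k := by
  unfold excess
  have hpos : (0 : ℝ) < (q : ℝ) ^ (t - ∑ i, k i) := pow_pos (Nat.cast_pos.mpr hq.pos) _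
  rcases excess_dichotomy hq g hk with h | h
  · rw [zeroCount_eq, h 0]; simp
  · have : (2 : ℝ) * (q : ℝ) ^ (t - ∑ i, k i) ≤ zeroCount t g k := by exact_mod_cast h
    linarith

lemma excess_eq_zero {q d t : ℕ} (hq : q.Prime) (g : Fin d → (ZMod q)[X]) {k : Fin d → ℕ}
    (hk : ∑ i, k i ≤ t) (hlt : excess t g k < (q : ℝ) ^ (t - ∑ i, k i)) : excess t g k = 0 := by
  unfold excess at *
  rcases excess_dichotomy hq g hk with h | h
  · rw [zeroCount_eq, h 0]; simp
  · have : (2 : ℝ) * (q : ℝ) ^ (t - ∑ i, k i) ≤ zeroCount t g k := by exact_mod_cast h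
    linarith

lemma prod_block_volume {q d t : ℕ} [NeZero q] {k : Fin d → ℕ} (e : Fin d → ℕ)
    (hk : ∑ i, k i ≤ t) :
    (q : ℝ) ^ t * ∏ i, ((((e i + 1) * q ^ (t - k i) : ℕ) : ℝ) - ((e i * q ^ (t - k i) : ℕ) : ℝ)) /
      (q : ℝ) ^ t = (q : ℝ) ^ (t - ∑ i, k i) := by
  have hq : (q : ℝ) ≠ 0 := Nat.cast_ne_zero.mpr (NeZero.ne q)
  have h : ∀ i, ((((e i + 1) * q ^ (t - k i) : ℕ) : ℝ) - ((e i * q ^ (t - k i) : ℕ) : ℝ)) /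
      (q : ℝ) ^ t = ((q : ℝ) ^ k i)⁻¹ := by
    intro i
    have hi : k i ≤ t := (Finset.single_le_sum (fun _ _ => Nat.zero_le _) (Finset.mem_univ i)).trans hk
    push_cast
    rw [pow_sub₀ _ hq hi]
    field_simp
    ring
  rw [Finset.prod_congr rfl fun i _ => h i, Finset.prod_inv_distrib, Finset.prod_pow_eq_pow_sum,
    pow_sub₀ _ hq hk]

lemma abs_boxDisc_block_le {q d t : ℕ} (hq : q.Prime) (g : Fin d → (ZMod q)[X]) {k e : Fin d → ℕ}
    (hk : ∑ i, k i ≤ t) (he : ∀ i, e i < q ^ k i) :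
    |boxDisc ((q : ℝ) ^ t) (netCoord (t := t) g) (fun i => e i * q ^ (t - k i))
      (fun i => (e i + 1) * q ^ (t - k i))| ≤ excess t g k := by
  have : NeZero q := ⟨hq.ne_zero⟩
  have hi : ∀ i, k i ≤ t := fun i =>
    (Finset.single_le_sum (fun _ _ => Nat.zero_le _) (Finset.mem_univ i)).trans hk
  unfold boxDisc excess
  rw [prod_block_volume e hk, Nat.card_congr (Equiv.subtypeEquivRight (mem_block_iff g hi he))]
  have hpos : (0 : ℝ) < (q : ℝ) ^ (t - ∑ i, k i) := pow_pos (Nat.cast_pos.mpr hq.pos) _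
  rcases excess_dichotomy hq g hk with h | h
  · rw [zeroCount_eq, h, h]; simp
  · have h2 : (2 : ℝ) * (q : ℝ) ^ (t - ∑ i, k i) ≤ zeroCount t g k := by exact_mod_cast h
    rcases card_fiber_eq_zero_or (leadingDigits t g k)
      (fun x => ((e x.1 / q ^ (x.2 : ℕ) % q : ℕ) : ZMod q)) with h0 | h0
    · rw [h0, abs_le]
      constructor <;> push_cast <;> linarith
    · rw [h0, ← zeroCount_eq, abs_of_nonneg]
      linarith

lemma abs_sum_blocks_le {F : ℕ → ℕ → ℝ} (hF : ∀ x y z, x ≤ y → y ≤ z → F x z = F x y + F y z)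
    (h x n : ℕ) {c : ℝ}
    (hc : ∀ e, x ≤ e → e < x + n → |F (e * h) ((e + 1) * h)| ≤ c) :
    |F (x * h) ((x + n) * h)| ≤ n * c := by
  induction n with
  | zero =>
    have := hF (x * h) (x * h) (x * h) le_rfl le_rfl
    have h0 : F (x * h) (x * h) = 0 := by linarith
    simp [h0]
  | succ n ih =>
    rw [hF (x * h) ((x + n) * h) _ (Nat.mul_le_mul_right _ (by omega))
      (Nat.mul_le_mul_right _ (by omega))]
    have h1 := ih fun e he he' => hc e he (by omega)
    have h2 := hc (x + n) (by omega) (by omega)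
    rw [← add_assoc x n 1]
    refine (abs_add_le _ _).trans ?_
    push_cast
    linarith

/-- Decomposition of `[0, a)`, truncated to its `M` leading digits, into elementary intervals. -/
lemma abs_truncated_le {q t a : ℕ} (hq : 2 ≤ q) (ha : a ≤ q ^ t) {F : ℕ → ℕ → ℝ}
    (hF : ∀ x y z, x ≤ y → y ≤ z → F x z = F x y + F y z) {Φ : ℕ → ℝ} (M : ℕ) (hM : M ≤ t)
    (hΦ : ∀ m ≤ M, ∀ e < q ^ m, |F (e * q ^ (t - m)) ((e + 1) * q ^ (t - m))| ≤ Φ m) :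
    |F 0 (a / q ^ (t - M) * q ^ (t - M))| ≤ ∑ m ∈ Finset.range (M + 1), q * Φ m := by
  have hpos : ∀ n, 0 < q ^ n := fun n => pow_pos (by omega) n
  have hΦ0 : ∀ m ≤ M, 0 ≤ Φ m := fun m hm => (abs_nonneg _).trans (hΦ m hm 0 (hpos m))
  induction M with
  | zero =>
    have h1 : a / q ^ t ≤ 1 := Nat.div_le_of_le_mul (by simpa using ha)
    have h2 := abs_sum_blocks_le hF (q ^ (t - 0)) 0 (a / q ^ t) (c := Φ 0)
      fun e _ he => hΦ 0 le_rfl e (by simp; omega)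
    simp only [zero_mul, zero_add, tsub_zero, Finset.range_one, Finset.sum_singleton] at h2 ⊢
    refine h2.trans (mul_le_mul_of_nonneg_right ?_ (hΦ0 0 le_rfl))
    exact_mod_cast h1.trans (by omega)
  | succ M ih =>
    have ih' := ih (by omega) (fun m hm => hΦ m (by omega)) (fun m hm => hΦ0 m (by omega))
    set h := q ^ (t - (M + 1)) with hh
    have hpow : q ^ (t - M) = h * q := by
      rw [hh, ← pow_succ]; congr 1; omega
    have hdiv : a / h = q * (a / q ^ (t - M)) + a / h % q := by
      rw [hpow, ← Nat.div_div_eq_div_mul, Nat.div_add_mod]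
    have hmod : a / h % q < q := Nat.mod_lt _ (by omega)
    have hle : a / h ≤ q ^ (M + 1) := by
      apply Nat.div_le_of_le_mul
      rw [hh, ← pow_add]
      exact ha.trans (Nat.pow_le_pow_right (by omega) (by omega))
    have h2 := abs_sum_blocks_le hF h (q * (a / q ^ (t - M))) (a / h % q) (c := Φ (M + 1))
      fun e _ he => hΦ (M + 1) le_rfl e (by omega)
    rw [← hdiv] at h2
    have hx : a / q ^ (t - M) * q ^ (t - M) = q * (a / q ^ (t - M)) * h := by
      rw [hpow]; ring
    rw [hx] at ih'
    rw [hF 0 (q * (a / q ^ (t - M)) * h) (a / h * h) (Nat.zero_le _)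
      (Nat.mul_le_mul_right _ (by omega)), Finset.sum_range_succ]
    refine (abs_add_le _ _).trans (add_le_add ih' (h2.trans ?_))
    exact mul_le_mul_of_nonneg_right (by exact_mod_cast hmod.le) (hΦ0 _ le_rfl)

lemma boxDisc_add {V : Type*} [Finite V] {d : ℕ} (N : ℝ) (y : V → Fin d → ℕ) (lo hi : Fin d → ℕ)
    (i₀ : Fin d) {a b c : ℕ} (hab : a ≤ b) (hbc : b ≤ c) :
    boxDisc N y (Function.update lo i₀ a) (Function.update hi i₀ c) =
      boxDisc N y (Function.update lo i₀ a) (Function.update hi i₀ b) +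
      boxDisc N y (Function.update lo i₀ b) (Function.update hi i₀ c) := by
  classical
  have hsplit : ∀ (x z : ℕ) (n : V), (∀ i, Function.update lo i₀ x i ≤ y n i ∧
      y n i < Function.update hi i₀ z i) ↔
      (x ≤ y n i₀ ∧ y n i₀ < z) ∧ ∀ i, i ≠ i₀ → lo i ≤ y n i ∧ y n i < hi i := by
    intro x z n
    constructor
    · intro h
      refine ⟨by simpa using h i₀, fun i hi => by simpa [hi] using h i⟩
    · rintro ⟨h1, h2⟩ i
      rcases eq_or_ne i i₀ with rfl | hi
      · simpa using h1
      · simpa [hi] using h2 i hi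
  have hvol : ∀ x z : ℕ, ∏ i, (((Function.update hi i₀ z i : ℕ) : ℝ) - (Function.update lo i₀ x i : ℕ)) / N
      = ((z : ℝ) - x) / N * ∏ i ∈ Finset.univ.erase i₀, ((hi i : ℝ) - lo i) / N := by
    intro x z
    rw [← Finset.mul_prod_erase _ _ (Finset.mem_univ i₀)]
    congr 1
    · simp
    · refine Finset.prod_congr rfl fun i hi => ?_
      simp [Finset.ne_of_mem_erase hi]
  have hcard : Nat.card {n : V // ∀ i, Function.update lo i₀ a i ≤ y n i ∧
        y n i < Function.update hi i₀ c i} =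
      Nat.card {n : V // ∀ i, Function.update lo i₀ a i ≤ y n i ∧
        y n i < Function.update hi i₀ b i} +
      Nat.card {n : V // ∀ i, Function.update lo i₀ b i ≤ y n i ∧
        y n i < Function.update hi i₀ c i} := by
    have := Fintype.ofFinite V
    simp only [hsplit, Nat.card_eq_fintype_card, Fintype.card_subtype]
    rw [← Finset.card_union_of_disjoint]
    · congr 1
      ext n
      simp only [Finset.mem_filter, Finset.mem_univ, true_and, Finset.mem_union]
      constructor
      · rintro ⟨⟨h1, h2⟩, h3⟩
        rcases lt_or_ge (y n i₀) b with h | h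
        · exact Or.inl ⟨⟨h1, h⟩, h3⟩
        · exact Or.inr ⟨⟨h, h2⟩, h3⟩
      · rintro (⟨⟨h1, h2⟩, h3⟩ | ⟨⟨h1, h2⟩, h3⟩)
        · exact ⟨⟨h1, by omega⟩, h3⟩
        · exact ⟨⟨by omega, h2⟩, h3⟩
    · rw [Finset.disjoint_left]
      intro n h h'
      simp only [Finset.mem_filter, Finset.mem_univ, true_and] at h h'
      omega
  unfold boxDisc
  rw [hcard, hvol, hvol, hvol]
  push_cast
  ring

lemma abs_boxDisc_le_of_subset {V : Type*} [Finite V] {d : ℕ} {N : ℝ} (hN : 0 < N)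
    (y : V → Fin d → ℕ) {lo hi lo' hi' : Fin d → ℕ} (h : ∀ i, lo i ≤ hi i)
    (hlo : ∀ i, lo' i ≤ lo i) (hhi : ∀ i, hi i ≤ hi' i)
    (hvol : N * ∏ i, ((hi' i : ℝ) - lo' i) / N = 1) {c : ℝ}
    (hc : |boxDisc N y lo' hi'| ≤ c) : |boxDisc N y lo hi| ≤ c + 1 := by
  have hcard : (Nat.card {n : V // ∀ i, lo i ≤ y n i ∧ y n i < hi i} : ℝ) ≤
      Nat.card {n : V // ∀ i, lo' i ≤ y n i ∧ y n i < hi' i} := by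
    have hsub : ∀ n : V, (∀ i, lo i ≤ y n i ∧ y n i < hi i) →
        ∀ i, lo' i ≤ y n i ∧ y n i < hi' i :=
      fun n hn i => ⟨(hlo i).trans (hn i).1, (hn i).2.trans_le (hhi i)⟩
    exact Nat.cast_le.mpr (Nat.card_le_card_of_injective (Subtype.map id hsub)
      (Subtype.map_injective _ Function.injective_id))
  have h0 : 0 ≤ N * ∏ i, ((hi i : ℝ) - lo i) / N := by
    refine mul_nonneg hN.le (Finset.prod_nonneg fun i _ => div_nonneg ?_ hN.le)
    exact sub_nonneg.mpr (Nat.cast_le.mpr (h i))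
  have h1 : N * ∏ i, ((hi i : ℝ) - lo i) / N ≤ 1 := by
    rw [← hvol]
    refine mul_le_mul_of_nonneg_left (Finset.prod_le_prod (fun i _ => div_nonneg ?_ hN.le)
      fun i _ => div_le_div_of_nonneg_right ?_ hN.le) hN.le
    · exact sub_nonneg.mpr (Nat.cast_le.mpr (h i))
    · exact sub_le_sub (Nat.cast_le.mpr (hhi i)) (Nat.cast_le.mpr (hlo i))
  have hn : (0 : ℝ) ≤ Nat.card {n : V // ∀ i, lo i ≤ y n i ∧ y n i < hi i} := Nat.cast_nonneg _
  have hc0 := (abs_nonneg _).trans hc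
  unfold boxDisc at hc ⊢
  rw [hvol] at hc
  have := (abs_le.mp hc).2
  rw [abs_le]
  constructor <;> linarith

/-- The shapes `k` of elementary boxes of order at most `t`. -/
def shapes (d t : ℕ) : Finset (Fin d → ℕ) :=
  {k ∈ Fintype.piFinset fun _ => Finset.range (t + 1) | ∑ i, k i ≤ t}

lemma mem_shapes {d t : ℕ} {k : Fin d → ℕ} : k ∈ shapes d t ↔ ∑ i, k i ≤ t := by
  simp only [shapes, Finset.mem_filter, Fintype.mem_piFinset, Finset.mem_range, and_iff_right_iff_imp]
  exact fun h i => Nat.lt_succ_of_le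
    ((Finset.single_le_sum (fun _ _ => Nat.zero_le _) (Finset.mem_univ i)).trans h)

lemma sum_extensions_le {d t j : ℕ} (hj : j < d) (k : Fin d → ℕ) {w : (Fin d → ℕ) → ℝ}
    (hw : ∀ k' ∈ shapes d t, 0 ≤ w k') (S : Finset ℕ) :
    ∑ m ∈ S, ∑ k' ∈ shapes d t with ∀ i : Fin d, i.val < j + 1 →
        k' i = Function.update k ⟨j, hj⟩ m i, w k' ≤
      ∑ k' ∈ shapes d t with ∀ i : Fin d, i.val < j → k' i = k i, w k' := by
  refine le_trans (le_of_eq ?_) (Finset.sum_fiberwise_le_sum_of_sum_fiber_nonneg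
    (t := S) (g := fun k' : Fin d → ℕ => k' ⟨j, hj⟩) fun m _ => Finset.sum_nonneg fun k' hk' =>
      hw k' (Finset.mem_filter.mp (Finset.mem_filter.mp hk').1).1)
  refine Finset.sum_congr rfl fun m _ => Finset.sum_congr ?_ fun _ _ => rfl
  ext k'
  simp only [Finset.mem_filter, and_assoc, and_congr_right_iff]
  intro _
  constructor
  · intro h
    refine ⟨fun i hi => ?_, by simpa using h ⟨j, hj⟩ (by simp)⟩
    have hne : i ≠ ⟨j, hj⟩ := fun e => by simp [e] at hi
    simpa [hne] using h i (by omega)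
  · rintro ⟨h1, h2⟩ i hi
    rcases eq_or_ne i ⟨j, hj⟩ with rfl | hne
    · simpa using h2
    · have : i.val ≠ j := fun e => hne (Fin.ext e)
      simpa [hne] using h1 i (by omega)

lemma abs_boxDisc_le_sum_aux {q d t : ℕ} (hq : 2 ≤ q) {V : Type*} [Finite V] (y : V → Fin d → ℕ)
    {δ : (Fin d → ℕ) → ℝ}
    (hδ : ∀ k e : Fin d → ℕ, ∑ i, k i ≤ t → (∀ i, e i < q ^ k i) →
      |boxDisc ((q : ℝ) ^ t) y (fun i => e i * q ^ (t - k i))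
        (fun i => (e i + 1) * q ^ (t - k i))| ≤ δ k)
    {a : Fin d → ℕ} (ha : ∀ i, a i ≤ q ^ t) (u : ℕ) :
    ∀ j, j + u = d → ∀ k e : Fin d → ℕ, (∀ i, j ≤ i.val → k i = 0) → (∀ i, e i < q ^ k i) →
      ∑ i, k i ≤ t →
      |boxDisc ((q : ℝ) ^ t) y (fun i => if i.val < j then e i * q ^ (t - k i) else 0)
        (fun i => if i.val < j then (e i + 1) * q ^ (t - k i) else a i)| ≤
        (q : ℝ) ^ u * (u + 1) * ∑ k' ∈ shapes d t with ∀ i : Fin d, i.val < j → k' i = k i,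
          (δ k' + if ∑ i, k' i = t then 1 else 0) := by
  have hpos : ∀ n, 0 < q ^ n := fun n => pow_pos (by omega) n
  have : NeZero q := ⟨by omega⟩
  have hδ0 : ∀ k : Fin d → ℕ, ∑ i, k i ≤ t → 0 ≤ δ k := fun k hk =>
    (abs_nonneg _).trans (hδ k (fun _ => 0) hk fun _ => hpos _)
  have hw : ∀ k ∈ shapes d t, 0 ≤ δ k + if ∑ i, k i = t then 1 else 0 := fun k hk =>
    add_nonneg (hδ0 k (mem_shapes.mp hk)) (by split_ifs <;> norm_num)
  induction u with
  | zero =>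
    intro j hj k e _ he hk
    have hlt : ∀ i : Fin d, i.val < j := fun i => by omega
    simp only [hlt, if_true, pow_zero, Nat.cast_zero, zero_add, one_mul, forall_true_left]
    refine (hδ k e hk he).trans (le_trans ?_ (Finset.single_le_sum (a := k) (fun k' hk' =>
      hw k' (Finset.mem_filter.mp hk').1) ?_))
    · exact le_add_of_nonneg_right (by split_ifs <;> norm_num)
    · simp [mem_shapes, hk]
  | succ u ih =>
    intro j hj k e hk0 he hk
    have hjd : j < d := by omega
    set i₀ : Fin d := ⟨j, hjd⟩ with hi₀
    set s := ∑ i, k i with hs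
    set lo : Fin d → ℕ := fun i => if i.val < j then e i * q ^ (t - k i) else 0 with hlo
    set hi : Fin d → ℕ := fun i => if i.val < j then (e i + 1) * q ^ (t - k i) else a i with hhi
    set F : ℕ → ℕ → ℝ := fun x z =>
      boxDisc ((q : ℝ) ^ t) y (Function.update lo i₀ x) (Function.update hi i₀ z) with hF
    have hFadd : ∀ x y z, x ≤ y → y ≤ z → F x z = F x y + F y z := fun x y z hxy hyz =>
      boxDisc_add _ _ _ _ _ hxy hyz
    have hsum : ∀ m, ∑ i, Function.update k i₀ m i = s + m := by
      intro m
      rw [Finset.sum_update_of_mem (Finset.mem_univ _), hs,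
        ← Finset.add_sum_erase _ _ (Finset.mem_univ i₀), hk0 i₀ le_rfl, zero_add, add_comm,
        Finset.sdiff_singleton_eq_erase]
    have hupd : ∀ m b : ℕ, b < q ^ m → ∀ i, Function.update e i₀ b i < q ^ Function.update k i₀ m i := by
      intro m b hb i
      rcases eq_or_ne i i₀ with rfl | hne
      · simpa using hb
      · simpa [hne] using he i
    set w : (Fin d → ℕ) → ℝ := fun k' => δ k' + if ∑ i, k' i = t then 1 else 0 with hwdef
    set Φ : ℕ → ℝ := fun m => (q : ℝ) ^ u * (u + 1) *
      ∑ k' ∈ shapes d t with ∀ i : Fin d, i.val < j + 1 → k' i = Function.update k i₀ m i, w k'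
      with hΦ
    have hblock : ∀ m ≤ t - s, ∀ b < q ^ m,
        |F (b * q ^ (t - m)) ((b + 1) * q ^ (t - m))| ≤ Φ m := by
      intro m hm b hb
      have := ih (j + 1) (by omega) (Function.update k i₀ m) (Function.update e i₀ b)
        (fun i hi => by
          have hne : i ≠ i₀ := fun h => by simp [h, hi₀] at hi
          simpa [hne] using hk0 i (by omega)) (hupd m b hb) (by rw [hsum]; omega)
      convert this using 3
      · funext i
        rcases eq_or_ne i i₀ with rfl | hne
        · simp [hi₀]
        · have : i.val ≠ j := fun h => hne (Fin.ext h)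
          have h' : i.val < j + 1 ↔ i.val < j := by omega
          simp [hne, hlo, h']
      · funext i
        rcases eq_or_ne i i₀ with rfl | hne
        · simp [hi₀]
        · have : i.val ≠ j := fun h => hne (Fin.ext h)
          have h' : i.val < j + 1 ↔ i.val < j := by omega
          simp [hne, hhi, h']
    have hmain := abs_truncated_le hq (ha i₀) hFadd (t - s) (Nat.sub_le _ _) hblock
    rw [Nat.sub_sub_self hk] at hmain
    have hrest : |F (a i₀ / q ^ s * q ^ s) (a i₀)| ≤ w (Function.update k i₀ (t - s)) := by
      have hsumt : ∑ i, Function.update k i₀ (t - s) i = t := by rw [hsum]; omega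
      have hw' : w (Function.update k i₀ (t - s)) = δ (Function.update k i₀ (t - s)) + 1 := by
        simp [hwdef, hsumt]
      rcases lt_or_ge (a i₀ / q ^ s) (q ^ (t - s)) with hlt | hge
      · rw [hw']
        have hu := hupd _ _ hlt
        refine abs_boxDisc_le_of_subset (by exact_mod_cast hpos t) y ?_ ?_ ?_ ?_
          (hδ _ _ hsumt.le hu)
        · intro i
          rcases eq_or_ne i i₀ with rfl | hne
          · simpa using Nat.div_mul_le_self _ _
          · simp only [ne_eq, hne, not_false_eq_true, Function.update_of_ne, hlo, hhi]
            split_ifs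
            · exact Nat.mul_le_mul_right _ (by omega)
            · exact Nat.zero_le _
        · intro i
          rcases eq_or_ne i i₀ with rfl | hne
          · simp [Nat.sub_sub_self hk]
          · simp only [ne_eq, hne, not_false_eq_true, Function.update_of_ne, hlo]
            split_ifs with hij
            · exact le_rfl
            · have h0 : k i = 0 := hk0 i (by omega)
              have := he i
              rw [h0, pow_zero] at this
              simp [Nat.lt_one_iff.mp this]
        · intro i
          rcases eq_or_ne i i₀ with rfl | hne
          · simp only [Function.update_self, Nat.sub_sub_self hk]
            have := Nat.lt_div_mul_add (a := a i₀) (hpos s)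
            rw [Nat.succ_mul]
            exact this.le
          · simp only [ne_eq, hne, not_false_eq_true, Function.update_of_ne, hhi]
            split_ifs with hij
            · exact le_rfl
            · have h0 : k i = 0 := hk0 i (by omega)
              have := he i
              rw [h0, pow_zero] at this
              simpa [Nat.lt_one_iff.mp this, h0] using ha i
        · rw [prod_block_volume _ hsumt.le, hsumt]
          simp
      · have h1 : a i₀ / q ^ s * q ^ s = a i₀ := by
          refine le_antisymm (Nat.div_mul_le_self _ _) ((ha i₀).trans ?_)
          calc q ^ t = q ^ (t - s) * q ^ s := by rw [← pow_add]; congr 1; omega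
            _ ≤ _ := Nat.mul_le_mul_right _ hge
        have h2 := hFadd (a i₀) (a i₀) (a i₀) le_rfl le_rfl
        rw [h1, show F (a i₀) (a i₀) = 0 by linarith, abs_zero]
        exact hw _ (mem_shapes.mpr hsumt.le)
    have hwle : w (Function.update k i₀ (t - s)) ≤
        ∑ k' ∈ shapes d t with ∀ i : Fin d, i.val < j → k' i = k i, w k' := by
      refine Finset.single_le_sum (f := w) (fun k' hk' => hw k' (Finset.mem_filter.mp hk').1) ?_
      rw [Finset.mem_filter, mem_shapes, hsum]
      refine ⟨by omega, fun i hij => ?_⟩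
      have hne : i ≠ i₀ := fun h => by simp [h, hi₀] at hij
      simp [hne]
    have hΦle : ∑ m ∈ Finset.range (t - s + 1), (q : ℝ) * Φ m ≤ (q : ℝ) ^ (u + 1) * (u + 1) *
        ∑ k' ∈ shapes d t with ∀ i : Fin d, i.val < j → k' i = k i, w k' := by
      have := sum_extensions_le hjd k hw (Finset.range (t - s + 1))
      simp only [hΦ]
      rw [← Finset.mul_sum, ← Finset.mul_sum, ← mul_assoc, ← mul_assoc, ← pow_succ']
      exact mul_le_mul_of_nonneg_left this (by positivity)
    have hbox : boxDisc ((q : ℝ) ^ t) y lo hi = F 0 (a i₀) := by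
      simp only [hF]
      congr 1
      · rw [eq_comm, Function.update_eq_self_iff]
        simp [hlo, hi₀]
      · rw [eq_comm, Function.update_eq_self_iff]
        simp [hhi, hi₀]
    rw [hbox, hFadd 0 _ _ (Nat.zero_le _) (Nat.div_mul_le_self (a i₀) (q ^ s))]
    refine (abs_add_le _ _).trans ((add_le_add (hmain.trans hΦle) (hrest.trans hwle)).trans ?_)
    set E := ∑ k' ∈ shapes d t with ∀ i : Fin d, i.val < j → k' i = k i, w k'
    have hE : 0 ≤ E := Finset.sum_nonneg fun k' hk' => hw k' (Finset.mem_filter.mp hk').1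
    have hqu : (1 : ℝ) ≤ (q : ℝ) ^ (u + 1) := one_le_pow₀ (by exact_mod_cast (by omega : 1 ≤ q))
    push_cast
    nlinarith [mul_nonneg (sub_nonneg.mpr hqu) hE]

lemma abs_boxDisc_le_sum {q d t : ℕ} (hq : q.Prime) (g : Fin d → (ZMod q)[X]) {a : Fin d → ℕ}
    (ha : ∀ i, a i ≤ q ^ t) :
    |boxDisc ((q : ℝ) ^ t) (netCoord (t := t) g) (fun _ => 0) a| ≤
      (q : ℝ) ^ d * (d + 1) * ∑ k ∈ shapes d t, (excess t g k + if ∑ i, k i = t then 1 else 0) := by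
  have : NeZero q := ⟨hq.ne_zero⟩
  simpa using abs_boxDisc_le_sum_aux hq.two_le (netCoord (t := t) g)
    (fun k e hk he => abs_boxDisc_block_le hq g hk he) ha d 0 (zero_add d) (fun _ => 0) (fun _ => 0)
    (fun _ _ => rfl) (fun _ => by simp) (by simp)

lemma card_mul_pow_le {q t a k : ℕ} [Fact q.Prime] (hak : a + k ≤ t) (p : PolyLT q t → Prop)
    (hp : ∀ r r', p r → p r' →
      (∀ m, m < a ∨ a + k ≤ m → ((r : (ZMod q)[X]) - (r' : (ZMod q)[X])).coeff m = 0) → r = r') :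
    Nat.card {r // p r} * q ^ k ≤ q ^ t := by
  rw [← card_polyLT q k, ← card_polyLT q t, ← Nat.card_prod]
  have hmem : ∀ c : PolyLT q k, X ^ a * (c : (ZMod q)[X]) ∈ degreeLT (ZMod q) t := fun c =>
    mem_degreeLT_of_coeff fun m hm => by
      rw [coeff_X_pow_mul']
      split_ifs
      · exact c.coeff_eq_zero (by omega)
      · rfl
  refine Nat.card_le_card_of_injective (fun x => x.1.1 + ⟨X ^ a * (x.2 : (ZMod q)[X]), hmem x.2⟩) ?_
  rintro ⟨⟨r, hr⟩, c⟩ ⟨⟨r', hr'⟩, c'⟩ h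
  have hval : (r : (ZMod q)[X]) + X ^ a * (c : (ZMod q)[X]) =
      (r' : (ZMod q)[X]) + X ^ a * (c' : (ZMod q)[X]) := congrArg Subtype.val h
  have hsub : (r : (ZMod q)[X]) - (r' : (ZMod q)[X]) = X ^ a * ((c' - c : PolyLT q k) : (ZMod q)[X]) := by
    push_cast
    linear_combination hval
  have hrr : r = r' := by
    refine hp r r' hr hr' fun m hm => ?_
    rw [hsub, coeff_X_pow_mul']
    split_ifs
    · exact (c' - c).coeff_eq_zero (by omega)
    · rfl
  subst hrr
  have hc : c = c' := Subtype.ext (mul_left_cancel₀ (pow_ne_zero a X_ne_zero) (add_left_cancel hval))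
  rw [hc]

lemma card_generators_mul_le {q t k : ℕ} [Fact q.Prime] (hk : k ≤ t) {n : PolyLT q t} (hn : n ≠ 0) :
    Nat.card {r : PolyLT q t // ∀ j < k,
      ((n : (ZMod q)[X]) * (1 + X * (r : (ZMod q)[X]))).coeff (t - k + j) = 0} * q ^ k ≤ q ^ t := by
  have hn' : (n : (ZMod q)[X]) ≠ 0 := fun h => hn (Subtype.ext h)
  set v := (n : (ZMod q)[X]).natTrailingDegree with hv
  have hnv : (n : (ZMod q)[X]).coeff v ≠ 0 := trailingCoeff_nonzero_iff_nonzero.mpr hn'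
  have hvt : v < t := by
    by_contra h
    exact hnv (n.coeff_eq_zero (not_lt.mp h))
  rcases le_or_gt (t - k) v with hle | hlt
  · have : IsEmpty {r : PolyLT q t // ∀ j < k,
        ((n : (ZMod q)[X]) * (1 + X * (r : (ZMod q)[X]))).coeff (t - k + j) = 0} := by
      refine ⟨fun ⟨r, hr⟩ => hnv ?_⟩
      have h := hr (v - (t - k)) (by omega)
      rw [show t - k + (v - (t - k)) = v by omega] at h
      obtain ⟨u, hu⟩ : X ^ v ∣ (n : (ZMod q)[X]) :=
        X_pow_dvd_iff.mpr fun m hm => coeff_eq_zero_of_lt_natTrailingDegree hm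
      rw [hu, mul_assoc, coeff_X_pow_mul', if_pos le_rfl, Nat.sub_self] at h
      rw [hu, coeff_X_pow_mul', if_pos le_rfl, Nat.sub_self]
      simpa [mul_coeff_zero] using h
    rw [Nat.card_of_isEmpty, zero_mul]
    exact Nat.zero_le _
  · refine card_mul_pow_le (a := t - k - v - 1) (by omega) _ fun r r' hr hr' hrr => ?_
    by_contra hne
    have hs : (r : (ZMod q)[X]) - (r' : (ZMod q)[X]) ≠ 0 := fun h => hne (Subtype.ext (sub_eq_zero.mp h))
    set s := (r : (ZMod q)[X]) - (r' : (ZMod q)[X]) with hsdef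
    have hsb : s.coeff s.natTrailingDegree ≠ 0 := trailingCoeff_nonzero_iff_nonzero.mpr hs
    have hb : ¬ (s.natTrailingDegree < t - k - v - 1 ∨
      t - k - v - 1 + k ≤ s.natTrailingDegree) := fun h => hsb (hrr _ h)
    have hXs : X * s ≠ 0 := mul_ne_zero X_ne_zero hs
    have hprod : (n : (ZMod q)[X]) * (X * s) ≠ 0 := mul_ne_zero hn' hXs
    have hdeg : ((n : (ZMod q)[X]) * (X * s)).natTrailingDegree = v + (1 + s.natTrailingDegree) := by
      rw [natTrailingDegree_mul hn' hXs, natTrailingDegree_mul X_ne_zero hs, natTrailingDegree_X]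
    refine trailingCoeff_nonzero_iff_nonzero.mpr hprod ?_
    have h1 := hr (s.natTrailingDegree - (t - k - v - 1)) (by omega)
    have h2 := hr' (s.natTrailingDegree - (t - k - v - 1)) (by omega)
    rw [show t - k + (s.natTrailingDegree - (t - k - v - 1)) = v + (1 + s.natTrailingDegree) by
      omega] at h1 h2
    rw [trailingCoeff, hdeg, show (n : (ZMod q)[X]) * (X * s) =
      (n : (ZMod q)[X]) * (1 + X * (r : (ZMod q)[X])) -
        (n : (ZMod q)[X]) * (1 + X * (r' : (ZMod q)[X])) by rw [hsdef]; ring, coeff_sub, h1, h2, sub_zero]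

lemma card_leading_zero_mul_le {q t k : ℕ} [Fact q.Prime] (hk : k ≤ t) :
    Nat.card {n : PolyLT q t // ∀ j < k, (n : (ZMod q)[X]).coeff (t - k + j) = 0} * q ^ k
      ≤ q ^ t := by
  refine card_mul_pow_le (a := t - k) (by omega) _ fun r r' hr hr' hrr => ?_
  ext m
  by_cases hm : m < t - k ∨ t - k + k ≤ m
  · have := hrr m hm
    rwa [coeff_sub, sub_eq_zero] at this
  · have h1 := hr (m - (t - k)) (by omega)
    have h2 := hr' (m - (t - k)) (by omega)
    rw [show t - k + (m - (t - k)) = m by omega] at h1 h2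
    rw [h1, h2]

/-- The family of generating vectors over which we average. -/
noncomputable def generators {q d t : ℕ} (i₀ : Fin d) (r : Fin d → PolyLT q t) (i : Fin d) :
    (ZMod q)[X] :=
  if i = i₀ then 1 else 1 + X * (r i : (ZMod q)[X])

lemma sum_zeroCount_mul_le {q d t : ℕ} [Fact q.Prime] [Fintype (PolyLT q t)] (i₀ : Fin d)
    {k : Fin d → ℕ} (hk : ∀ i, k i ≤ t) :
    (∑ r : Fin d → PolyLT q t, zeroCount t (generators i₀ r) k) * q ^ ∑ i, k i ≤
      (q ^ t) ^ d * (q ^ (∑ i, k i) + q ^ t) := by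
  classical
  have hV : Fintype.card (PolyLT q t) = q ^ t := by
    rw [← Nat.card_eq_fintype_card, card_polyLT]
  let c : Fin d → PolyLT q t → PolyLT q t → Prop := fun i n x => ∀ j < k i,
    ((n : (ZMod q)[X]) * if i = i₀ then 1 else 1 + X * (x : (ZMod q)[X])).coeff (t - k i + j) = 0
  have hswap : ∑ r : Fin d → PolyLT q t, zeroCount t (generators i₀ r) k =
      ∑ n : PolyLT q t, Nat.card {r : Fin d → PolyLT q t // ∀ i, c i n (r i)} := by
    simp only [zeroCount, Nat.card_eq_fintype_card, Fintype.card_subtype, Finset.card_filter]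
    rw [Finset.sum_comm]
    rfl
  have hcard : ∀ n, Nat.card {r : Fin d → PolyLT q t // ∀ i, c i n (r i)} =
      ∏ i, Nat.card {x // c i n x} := fun n => by
    rw [Nat.card_congr Equiv.subtypePiEquivPi, Nat.card_pi]
  have hzero : Nat.card {r : Fin d → PolyLT q t // ∀ i, c i 0 (r i)} ≤ (q ^ t) ^ d := by
    refine (Nat.card_le_card_of_injective _ Subtype.val_injective).trans ?_
    simp [hV]
  have hne : ∀ n ≠ 0, (∏ i, Nat.card {x // c i n x}) * q ^ ∑ i, k i ≤
      Nat.card {x // c i₀ n x} * q ^ k i₀ * (q ^ t) ^ (d - 1) := by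
    intro n hn
    rw [← Finset.prod_pow_eq_pow_sum, ← Finset.prod_mul_distrib,
      ← Finset.mul_prod_erase _ _ (Finset.mem_univ i₀)]
    refine Nat.mul_le_mul_left _ ((Finset.prod_le_pow_card _ _ (q ^ t) fun i hi => ?_).trans ?_)
    · have := card_generators_mul_le (hk i) hn
      simpa only [c, if_neg (Finset.ne_of_mem_erase hi)] using this
    · simp
  have hfirst : ∑ n : PolyLT q t, Nat.card {x // c i₀ n x} * q ^ k i₀ ≤ q ^ t * q ^ t := by
    have h := card_leading_zero_mul_le (q := q) (hk i₀)
    have h1 : ∀ n : PolyLT q t, Nat.card {x // c i₀ n x} =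
        if ∀ j < k i₀, (n : (ZMod q)[X]).coeff (t - k i₀ + j) = 0 then q ^ t else 0 := by
      intro n
      simp only [c, if_true, mul_one]
      split_ifs with hc
      · exact (Nat.card_congr (Equiv.subtypeUnivEquiv fun _ => hc)).trans (card_polyLT q t)
      · simp [hc]
    rw [← Finset.sum_mul, Finset.sum_congr rfl fun n _ => h1 n, Finset.sum_ite,
      Finset.sum_const_zero, add_zero, Finset.sum_const, smul_eq_mul, ← Fintype.card_subtype,
      ← Nat.card_eq_fintype_card, mul_right_comm, mul_comm]
    exact Nat.mul_le_mul_left _ h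
  rw [hswap, ← Finset.add_sum_erase _ _ (Finset.mem_univ (0 : PolyLT q t)), add_mul, mul_add]
  refine Nat.add_le_add (Nat.mul_le_mul_right _ hzero) ?_
  rw [Finset.sum_mul]
  calc ∑ n ∈ Finset.univ.erase (0 : PolyLT q t),
        Nat.card {r : Fin d → PolyLT q t // ∀ i, c i n (r i)} * q ^ ∑ i, k i
      ≤ ∑ n ∈ Finset.univ.erase (0 : PolyLT q t),
        Nat.card {x // c i₀ n x} * q ^ k i₀ * (q ^ t) ^ (d - 1) :=
        Finset.sum_le_sum fun n hn => by
          rw [hcard]; exact hne n (Finset.ne_of_mem_erase hn)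
    _ ≤ ∑ n : PolyLT q t, Nat.card {x // c i₀ n x} * q ^ k i₀ * (q ^ t) ^ (d - 1) :=
        Finset.sum_le_sum_of_subset (Finset.erase_subset _ _)
    _ ≤ q ^ t * q ^ t * (q ^ t) ^ (d - 1) := by
        rw [← Finset.sum_mul]; exact Nat.mul_le_mul_right _ hfirst
    _ = (q ^ t) ^ d * q ^ t := by
        obtain ⟨D, rfl⟩ : ∃ D, d = D + 1 := ⟨d - 1, by have := i₀.pos; omega⟩
        rw [Nat.add_sub_cancel, pow_succ (q ^ t) D]
        ring

lemma sum_excess_le {q d t : ℕ} [Fact q.Prime] [Fintype (PolyLT q t)] (i₀ : Fin d)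
    {k : Fin d → ℕ} (hk : ∑ i, k i ≤ t) :
    ∑ r : Fin d → PolyLT q t, excess t (generators i₀ r) k ≤
      Fintype.card (Fin d → PolyLT q t) := by
  have hq : (0 : ℝ) < q := Nat.cast_pos.mpr (Fact.out : q.Prime).pos
  have hV : Fintype.card (PolyLT q t) = q ^ t := by
    rw [← Nat.card_eq_fintype_card, card_polyLT]
  have h := sum_zeroCount_mul_le (q := q) i₀ fun i =>
    (Finset.single_le_sum (fun _ _ => Nat.zero_le _) (Finset.mem_univ i)).trans hk
  have h' : (∑ r : Fin d → PolyLT q t, (zeroCount t (generators i₀ r) k : ℝ)) * q ^ ∑ i, k i ≤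
      ((q : ℝ) ^ t) ^ d * ((q : ℝ) ^ (∑ i, k i) + (q : ℝ) ^ t) := by exact_mod_cast h
  have hsplit : (q : ℝ) ^ t = (q : ℝ) ^ (t - ∑ i, k i) * (q : ℝ) ^ ∑ i, k i := by
    rw [← pow_add, Nat.sub_add_cancel hk]
  have hpos : (0 : ℝ) < (q : ℝ) ^ ∑ i, k i := pow_pos hq _
  have hcard : (Fintype.card (Fin d → PolyLT q t) : ℝ) = ((q : ℝ) ^ t) ^ d := by
    simp [hV]
  simp only [excess, Finset.sum_sub_distrib, Finset.sum_const, Finset.card_univ, nsmul_eq_mul]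
  rw [hcard]
  refine le_of_mul_le_mul_right ?_ hpos
  rw [sub_mul, mul_assoc, ← hsplit]
  linarith

lemma card_shapes_le (d t : ℕ) : (shapes d t).card ≤ (t + 1) ^ d := by
  refine (Finset.card_filter_le _ _).trans ?_
  simp

lemma card_shapes_sum_eq_le (D t s : ℕ) :
    ((shapes (D + 1) t).filter fun k => ∑ i, k i = s).card ≤ (t + 1) ^ D := by
  have : (Fintype.piFinset fun _ : Fin D => Finset.range (t + 1)).card = (t + 1) ^ D := by simp
  rw [← this]
  refine Finset.card_le_card_of_injOn Fin.tail (fun k hk => ?_) fun k hk k' hk' h => ?_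
  · have hk := mem_shapes.mp (Finset.mem_filter.mp hk).1
    simp only [Finset.mem_coe, Fintype.mem_piFinset, Finset.mem_range, Fin.tail]
    exact fun i => Nat.lt_succ_of_le
      ((Finset.single_le_sum (fun _ _ => Nat.zero_le _) (Finset.mem_univ i.succ)).trans hk)
  · have h1 := (Finset.mem_filter.mp hk).2
    have h2 := (Finset.mem_filter.mp hk').2
    rw [Fin.sum_univ_succ] at h1 h2
    have h3 : ∀ i : Fin D, k i.succ = k' i.succ := fun i => congrFun h i
    simp only [h3] at h1
    funext i
    refine Fin.cases ?_ h3 i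
    omega

lemma card_shapes_near_le (D t r : ℕ) :
    ((shapes (D + 1) t).filter fun k => t < ∑ i, k i + r).card ≤ r * (t + 1) ^ D := by
  have hsub : ((shapes (D + 1) t).filter fun k => t < ∑ i, k i + r) ⊆
      (Finset.range r).biUnion fun u => (shapes (D + 1) t).filter fun k => ∑ i, k i = t - u := by
    intro k hk
    obtain ⟨hk, hlt⟩ := Finset.mem_filter.mp hk
    have := mem_shapes.mp hk
    simp only [Finset.mem_biUnion, Finset.mem_range, Finset.mem_filter]
    exact ⟨t - ∑ i, k i, by omega, hk, by omega⟩
  refine (Finset.card_le_card hsub).trans ((Finset.card_biUnion_le_card_mul _ _ _ fun u _ =>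
    card_shapes_sum_eq_le D t (t - u)).trans ?_)
  simp

/-- Existence of generators whose total excess is small. -/
lemma exists_generators {q D t r : ℕ} [Fact q.Prime] (i₀ : Fin (D + 1))
    (hr : 2 * (t + 1) ^ (D + 1) < q ^ r) :
    ∃ x : Fin (D + 1) → PolyLT q t,
      ∑ k ∈ shapes (D + 1) t, excess t (generators i₀ x) k ≤ 2 * ((r + 1) * (t + 1) ^ D) := by
  have hq : q.Prime := Fact.out
  have hq0 : (0 : ℝ) < q := Nat.cast_pos.mpr hq.pos
  have := Fintype.ofFinite (PolyLT q t)
  set M : ℝ := (r + 1) * (t + 1) ^ D with hM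
  have hM0 : 0 < M := by positivity
  set S := shapes (D + 1) t with hS
  set S₁ := S.filter fun k => ¬ t < ∑ i, k i + r with hS₁
  set S₂ := S.filter fun k => t < ∑ i, k i + r with hS₂
  have hmem₁ : ∀ k ∈ S₁, ∑ i, k i + r ≤ t := fun k hk => not_lt.mp (Finset.mem_filter.mp hk).2
  have hmem₂ : ∀ k ∈ S₂, ∑ i, k i ≤ t := fun k hk => mem_shapes.mp (Finset.mem_filter.mp hk).1
  let w : (Fin (D + 1) → PolyLT q t) → ℝ := fun x =>
    ∑ k ∈ S₁, excess t (generators i₀ x) k / (q : ℝ) ^ (t - ∑ i, k i) +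
      ∑ k ∈ S₂, excess t (generators i₀ x) k / (2 * M)
  have hΩ : (0 : ℝ) < Fintype.card (Fin (D + 1) → PolyLT q t) := by
    exact_mod_cast Fintype.card_pos
  set Ω : ℝ := ((Fintype.card (Fin (D + 1) → PolyLT q t) : ℕ) : ℝ) with hΩdef
  have hsum : ∑ x, w x < ∑ x : Fin (D + 1) → PolyLT q t, (1 : ℝ) := by
    simp only [w, Finset.sum_add_distrib]
    rw [Finset.sum_comm, Finset.sum_comm (t := S₂)]
    simp only [← Finset.sum_div]
    have h1 : ∑ k ∈ S₁, (∑ x : Fin (D + 1) → PolyLT q t, excess t (generators i₀ x) k) /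
        (q : ℝ) ^ (t - ∑ i, k i) ≤ (t + 1) ^ (D + 1) * (Ω / (q : ℝ) ^ r) := by
      refine (Finset.sum_le_card_nsmul _ _ (Ω / (q : ℝ) ^ r) fun k hk => ?_).trans ?_
      · have := hmem₁ k hk
        refine div_le_div₀ hΩ.le (sum_excess_le i₀ (by omega)) (pow_pos hq0 _) ?_
        exact pow_le_pow_right₀ (by exact_mod_cast hq.one_le) (by omega)
      · rw [nsmul_eq_mul]
        refine mul_le_mul_of_nonneg_right ?_ (by positivity)
        exact_mod_cast (Finset.card_filter_le _ _).trans (card_shapes_le (D + 1) t)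
    have h2 : ∑ k ∈ S₂, (∑ x : Fin (D + 1) → PolyLT q t, excess t (generators i₀ x) k) ≤ M * Ω := by
      refine (Finset.sum_le_card_nsmul _ _ Ω fun k hk => sum_excess_le i₀ (hmem₂ k hk)).trans ?_
      rw [nsmul_eq_mul]
      refine mul_le_mul_of_nonneg_right ?_ hΩ.le
      have h3 : (S₂.card : ℝ) ≤ r * (t + 1) ^ D := by exact_mod_cast card_shapes_near_le D t r
      have h4 : (0 : ℝ) ≤ (t + 1 : ℝ) ^ D := by positivity
      rw [hM]
      linarith
    have h3 : (t + 1 : ℝ) ^ (D + 1) * (Ω / (q : ℝ) ^ r) < Ω / 2 := by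
      have hr' : 2 * (t + 1 : ℝ) ^ (D + 1) < (q : ℝ) ^ r := by exact_mod_cast hr
      rw [mul_div_assoc', div_lt_iff₀ (pow_pos hq0 _)]
      have := mul_lt_mul_of_pos_right hr' hΩ
      linarith
    have h4 : (∑ k ∈ S₂, ∑ x : Fin (D + 1) → PolyLT q t, excess t (generators i₀ x) k) / (2 * M) ≤
        Ω / 2 := by
      rw [div_le_iff₀ (by positivity)]
      linarith
    rw [Finset.sum_const, nsmul_eq_mul, mul_one, Finset.card_univ, ← hΩdef]
    linarith
  obtain ⟨x, -, hx⟩ := Finset.exists_lt_of_sum_lt hsum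
  refine ⟨x, ?_⟩
  have hnn₁ : ∀ k ∈ S₁, 0 ≤ excess t (generators i₀ x) k / (q : ℝ) ^ (t - ∑ i, k i) :=
    fun k hk => div_nonneg (excess_nonneg hq _ (by have := hmem₁ k hk; omega)) (pow_pos hq0 _).le
  have hnn₂ : ∀ k ∈ S₂, 0 ≤ excess t (generators i₀ x) k / (2 * M) :=
    fun k hk => div_nonneg (excess_nonneg hq _ (hmem₂ k hk)) (by positivity)
  have hz : ∀ k ∈ S₁, excess t (generators i₀ x) k = 0 := by
    intro k hk
    have h1 := Finset.single_le_sum hnn₁ hk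
    have h2 := Finset.sum_nonneg hnn₂
    refine excess_eq_zero hq _ (by have := hmem₁ k hk; omega) ?_
    have h3 : excess t (generators i₀ x) k / (q : ℝ) ^ (t - ∑ i, k i) < 1 := by
      simp only [w] at hx; linarith
    rwa [div_lt_one (pow_pos hq0 _)] at h3
  have h2 : ∑ k ∈ S₂, excess t (generators i₀ x) k < 2 * M := by
    have h1 := Finset.sum_nonneg hnn₁
    have h3 : (∑ k ∈ S₂, excess t (generators i₀ x) k) / (2 * M) < 1 := by
      simp only [w, ← Finset.sum_div] at hx
      linarith
    rwa [div_lt_one (by positivity)] at h3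
  rw [← Finset.sum_filter_add_sum_filter_not S (fun k => t < ∑ i, k i + r),
    Finset.sum_eq_zero hz, add_zero]
  exact h2.le

lemma abs_prod_sub_prod_le_sum {ι : Type*} (s : Finset ι) {x y : ι → ℝ}
    (hx : ∀ i ∈ s, 0 ≤ x i ∧ x i ≤ 1) (hy : ∀ i ∈ s, 0 ≤ y i ∧ y i ≤ 1) :
    |∏ i ∈ s, x i - ∏ i ∈ s, y i| ≤ ∑ i ∈ s, |x i - y i| := by
  classical
  induction s using Finset.induction_on with
  | empty => simp
  | insert i s hi ih =>
    simp only [Finset.forall_mem_insert] at hx hy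
    rw [Finset.prod_insert hi, Finset.prod_insert hi, Finset.sum_insert hi,
      show x i * ∏ j ∈ s, x j - y i * ∏ j ∈ s, y j =
        (x i - y i) * ∏ j ∈ s, x j + y i * (∏ j ∈ s, x j - ∏ j ∈ s, y j) by ring]
    refine (abs_add_le _ _).trans (add_le_add ?_ ?_)
    · rw [abs_mul]
      refine mul_le_of_le_one_right (abs_nonneg _) ?_
      rw [abs_of_nonneg (Finset.prod_nonneg fun j hj => (hx.2 j hj).1)]
      exact Finset.prod_le_one (fun j hj => (hx.2 j hj).1) fun j hj => (hx.2 j hj).2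
    · rw [abs_mul, abs_of_nonneg hy.1.1]
      exact (mul_le_of_le_one_left (abs_nonneg _) hy.1.2).trans (ih hx.2 hy.2)

lemma starDisc_ratNet_le {q d t : ℕ} (hq : q.Prime) (g : Fin d → (ZMod q)[X]) {C : ℝ}
    (hC : ∀ a : Fin d → ℕ, (∀ i, a i ≤ q ^ t) →
      |boxDisc ((q : ℝ) ^ t) (netCoord (t := t) g) (fun _ => 0) a| ≤ C) :
    starDisc (ratNet d t g) (q ^ t) ≤ (C + d) / (q : ℝ) ^ t := by
  have : NeZero q := ⟨hq.ne_zero⟩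
  have hN : (0 : ℝ) < (q : ℝ) ^ t := pow_pos (Nat.cast_pos.mpr hq.pos) _
  have hC0 : 0 ≤ C := (abs_nonneg _).trans (hC (fun _ => 0) fun _ => Nat.zero_le _)
  refine Real.sSup_le ?_ (by positivity)
  rintro _ ⟨v, hv, rfl⟩
  set a : Fin d → ℕ := fun i => ⌈v i * (q : ℝ) ^ t⌉₊ with ha
  have haN : ∀ i, a i ≤ q ^ t := fun i => Nat.ceil_le.mpr (by
    push_cast
    exact mul_le_of_le_one_left hN.le (hv i).2)
  have hcard : Nat.card {n : ℕ // n < q ^ t ∧ ∀ i, 0 ≤ ratNet d t g n i ∧ ratNet d t g n i < v i} =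
      Nat.card {n : PolyLT q t // ∀ i, 0 ≤ netCoord g n i ∧ netCoord g n i < a i} := by
    refine Nat.card_congr ((Equiv.subtypeSubtypeEquivSubtypeInter _ _).symm.trans
      (Equiv.subtypeEquiv (natPolyEquiv q t hq.two_le) fun n => forall_congr' fun i => ?_))
    rw [ratNet_eq]
    have h1 : (0 : ℝ) ≤ (digitSum (natPoly q n * g i).coeff t : ℝ) / (q : ℝ) ^ t := by positivity
    simp only [h1, true_and, Nat.zero_le]
    rw [div_lt_iff₀ hN, ← Nat.lt_ceil]
    rfl
  have hbox := hC a haN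
  have hprod : |∏ i, (a i : ℝ) / (q : ℝ) ^ t - ∏ i, v i| ≤ d / (q : ℝ) ^ t := by
    refine (abs_prod_sub_prod_le_sum Finset.univ (fun i _ => ⟨by positivity, ?_⟩)
      fun i _ => ⟨(hv i).1.le, (hv i).2⟩).trans ?_
    · rw [div_le_one hN]
      exact_mod_cast haN i
    · refine (Finset.sum_le_card_nsmul _ _ (1 / (q : ℝ) ^ t) fun i _ => ?_).trans (le_of_eq ?_)
      · have h1 := Nat.le_ceil (v i * (q : ℝ) ^ t)
        have h2 := Nat.ceil_lt_add_one (mul_nonneg (hv i).1.le hN.le)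
        have h3 : (a i : ℝ) / (q : ℝ) ^ t - v i = (a i - v i * (q : ℝ) ^ t) / (q : ℝ) ^ t := by
          field_simp
        rw [h3, abs_of_nonneg (div_nonneg (sub_nonneg.mpr h1) hN.le)]
        exact div_le_div_of_nonneg_right (by linarith) hN.le
      · simp [div_eq_mul_inv]
  unfold boxDisc at hbox
  rw [← hcard] at hbox
  set K : ℝ := ((Nat.card {n : ℕ // n < q ^ t ∧
    ∀ i, 0 ≤ ratNet d t g n i ∧ ratNet d t g n i < v i} : ℕ) : ℝ)
  simp only [Nat.cast_zero, sub_zero] at hbox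
  have hsplit : K / ((q ^ t : ℕ) : ℝ) - ∏ i, v i =
      (K - (q : ℝ) ^ t * ∏ i, (a i : ℝ) / (q : ℝ) ^ t) / (q : ℝ) ^ t +
        (∏ i, (a i : ℝ) / (q : ℝ) ^ t - ∏ i, v i) := by
    push_cast
    field_simp
    ring
  rw [hsplit, add_div]
  refine (abs_add_le _ _).trans (add_le_add ?_ hprod)
  rw [abs_div, abs_of_pos hN]
  exact div_le_div_of_nonneg_right hbox hN.le

lemma isCoprime_generators {q d t : ℕ} (i₀ : Fin d) (r : Fin d → PolyLT q t) (i : Fin d) :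
    IsCoprime (generators i₀ r i) X := by
  unfold generators
  split_ifs
  · exact isCoprime_one_left
  · exact ⟨1, -(r i : (ZMod q)[X]), by ring⟩

lemma log_le_four_mul_log_mul_log {q t : ℕ} (hq : 2 ≤ q) (ht : 2 ≤ t) :
    Real.log t ≤ 4 * Real.log (t * Real.log q) := by
  have h2 : (0.69 : ℝ) < Real.log q :=
    lt_of_lt_of_le (by have := Real.log_two_gt_d9; linarith)
      (Real.log_le_log two_pos (by exact_mod_cast hq : (2 : ℝ) ≤ q))
  have ht' : (2 : ℝ) ≤ t := by exact_mod_cast ht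
  have h4 : 4 * Real.log (t * Real.log q) = Real.log ((t * Real.log q) ^ 4) := by
    rw [Real.log_pow]; norm_num
  rw [h4]
  refine Real.log_le_log (by linarith) ?_
  have h5 : (0.69 : ℝ) ^ 4 ≤ Real.log q ^ 4 := pow_le_pow_left₀ (by norm_num) h2.le 4
  have h6 : (2 : ℝ) ^ 3 ≤ (t : ℝ) ^ 3 := pow_le_pow_left₀ (by norm_num) ht' 3
  calc (t : ℝ) ≤ t * (2 ^ 3 * 0.69 ^ 4) := le_mul_of_one_le_right (by linarith) (by norm_num)
    _ ≤ t * ((t : ℝ) ^ 3 * Real.log q ^ 4) := by gcongr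
    _ = (t * Real.log q) ^ 4 := by ring

lemma log_two_mul_pow_le {d t : ℕ} (ht : 2 ≤ t) :
    (Nat.log 2 (2 * (t + 1) ^ d) : ℝ) ≤ 1 + 4 * d * Real.log t := by
  have h2 : (1 / 2 : ℝ) < Real.log 2 := by have := Real.log_two_gt_d9; linarith
  have ht' : (2 : ℝ) ≤ t := by exact_mod_cast ht
  have hpow : (2 : ℝ) ^ Nat.log 2 (2 * (t + 1) ^ d) ≤ 2 * (t + 1) ^ d := by
    exact_mod_cast Nat.pow_log_le_self 2 (by positivity)
  have h := Real.log_le_log (by positivity) hpow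
  rw [Real.log_pow, Real.log_mul two_ne_zero (by positivity), Real.log_pow] at h
  have h1 : Real.log (t + 1) ≤ 2 * Real.log t := by
    have : Real.log ((t : ℝ) ^ 2) = 2 * Real.log t := by rw [Real.log_pow]; norm_num
    rw [← this]
    exact Real.log_le_log (by linarith) (by nlinarith)
  have h3 : 0 ≤ Real.log t := Real.log_nonneg (by linarith)
  have h4 : (d : ℝ) * Real.log (t + 1) ≤ d * (2 * Real.log t) :=
    mul_le_mul_of_nonneg_left h1 (Nat.cast_nonneg d)
  have h5 : (0 : ℝ) ≤ d * Real.log t := mul_nonneg (Nat.cast_nonneg d) h3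
  have h6 : (Nat.log 2 (2 * (t + 1) ^ d) : ℝ) * Real.log 2 ≤
      (1 + 4 * d * Real.log t) * Real.log 2 := by
    nlinarith
  exact le_of_mul_le_mul_right h6 (by linarith)

lemma final_estimate {q D t : ℕ} (hq : 2 ≤ q) (ht : 2 ≤ t) {r : ℕ}
    (hr : r = Nat.log 2 (2 * (t + 1) ^ (D + 1)) + 1) :
    (q : ℝ) ^ (D + 1) * ((D + 1 : ℕ) + 1) * (2 * ((r + 1) * (t + 1) ^ D) + (t + 1) ^ D) +
        (D + 1 : ℕ) <
      (((q : ℝ) ^ (D + 1) * ((D + 1 : ℕ) + 1) * (56 + 32 * (D + 1)) + 8 * (D + 1)) * 4 ^ D + 1) *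
        Real.log (q ^ t : ℕ) ^ D * Real.log (Real.log (q ^ t : ℕ)) := by
  have h2 : (1 / 2 : ℝ) < Real.log q :=
    lt_of_lt_of_le (by have := Real.log_two_gt_d9; linarith)
      (Real.log_le_log two_pos (by exact_mod_cast hq : (2 : ℝ) ≤ q))
  have ht' : (2 : ℝ) ≤ t := by exact_mod_cast ht
  have hlogN : Real.log (q ^ t : ℕ) = t * Real.log q := by push_cast; rw [Real.log_pow]
  rw [hlogN]
  set ℓ : ℝ := t * Real.log q with hℓ
  set L : ℝ := Real.log ℓ with hL
  have hlog : Real.log t ≤ 4 * L := log_le_four_mul_log_mul_log hq ht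
  have hlogt : (1 / 2 : ℝ) ≤ Real.log t :=
    le_trans (by have := Real.log_two_gt_d9; linarith) (Real.log_le_log two_pos ht')
  have hL1 : 1 ≤ 8 * L := by linarith
  have hL0 : 0 ≤ L := by linarith
  have hℓ1 : 1 ≤ 4 * ℓ := by nlinarith
  have hℓ0 : 0 < ℓ := by linarith
  have htℓ : ((t : ℝ) + 1) ^ D ≤ 4 ^ D * ℓ ^ D := by
    rw [← mul_pow]
    exact pow_le_pow_left₀ (by positivity) (by nlinarith) D
  have hone : 1 ≤ (4 : ℝ) ^ D * ℓ ^ D := by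
    rw [← mul_pow]
    exact one_le_pow₀ hℓ1
  have hrL : 2 * (r : ℝ) + 3 ≤ (56 + 32 * (D + 1)) * L := by
    have h := log_two_mul_pow_le (d := D + 1) ht
    rw [hr]
    push_cast at h ⊢
    have hD : (0 : ℝ) ≤ D := Nat.cast_nonneg D
    have h1 : ((D : ℝ) + 1) * Real.log t ≤ (D + 1) * (4 * L) :=
      mul_le_mul_of_nonneg_left hlog (by positivity)
    linarith
  set P : ℝ := 4 ^ D * ℓ ^ D with hP
  set A : ℝ := (q : ℝ) ^ (D + 1) * ((D + 1 : ℕ) + 1) with hA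
  have hA0 : 0 ≤ A := by positivity
  have hmain : (2 * ((r + 1) * (t + 1) ^ D) + (t + 1) ^ D : ℝ) ≤ (56 + 32 * (D + 1)) * L * P := by
    calc (2 * ((r + 1) * (t + 1) ^ D) + (t + 1) ^ D : ℝ) = (2 * r + 3) * (t + 1) ^ D := by ring
      _ ≤ _ := mul_le_mul hrL htℓ (by positivity) (by positivity)
  have hd : ((D + 1 : ℕ) : ℝ) ≤ 8 * (D + 1) * (L * P) := by
    have : 1 ≤ 8 * L * P := one_le_mul_of_one_le_of_one_le hL1 hone
    have h3 := mul_le_mul_of_nonneg_left this (by positivity : (0 : ℝ) ≤ D + 1)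
    push_cast
    linarith
  have hpos : 0 < ℓ ^ D * L := mul_pos (pow_pos hℓ0 D) (by linarith)
  calc A * (2 * ((r + 1) * (t + 1) ^ D) + (t + 1) ^ D) + (D + 1 : ℕ)
      ≤ A * ((56 + 32 * (D + 1)) * L * P) + 8 * (D + 1) * (L * P) :=
        add_le_add (mul_le_mul_of_nonneg_left hmain hA0) hd
    _ < A * ((56 + 32 * (D + 1)) * L * P) + 8 * (D + 1) * (L * P) + ℓ ^ D * L := by linarith
    _ = _ := by rw [hP]; ring

theorem stmt8 (d q : ℕ) (hd : 1 ≤ d) (hq : q.Prime) :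
    ∃ c > 0, ∀ t : ℕ, 2 ≤ t →
      ∃ g : Fin d → Polynomial (ZMod q),
        g ⟨0, hd⟩ = 1 ∧ (∀ i, IsCoprime (g i) Polynomial.X) ∧
        starDisc (ratNet d t g) (q ^ t)
          < c * Real.log (q ^ t : ℕ) ^ (d - 1) * Real.log (Real.log (q ^ t : ℕ))
              / ((q : ℝ) ^ t) := by
  obtain ⟨D, rfl⟩ : ∃ D, d = D + 1 := ⟨d - 1, by omega⟩
  have : Fact q.Prime := ⟨hq⟩
  refine ⟨((q : ℝ) ^ (D + 1) * ((D + 1 : ℕ) + 1) * (56 + 32 * (D + 1)) + 8 * (D + 1)) * 4 ^ D + 1,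
    by positivity, fun t ht => ?_⟩
  obtain ⟨r, hr⟩ : ∃ r, r = Nat.log 2 (2 * (t + 1) ^ (D + 1)) + 1 := ⟨_, rfl⟩
  have hqr : 2 * (t + 1) ^ (D + 1) < q ^ r := by
    rw [hr]
    exact (Nat.lt_pow_succ_log_self one_lt_two _).trans_le (Nat.pow_le_pow_left hq.two_le _)
  obtain ⟨x, hx⟩ := exists_generators (q := q) (⟨0, hd⟩ : Fin (D + 1)) hqr
  refine ⟨generators ⟨0, hd⟩ x, by simp [generators], isCoprime_generators _ x, ?_⟩
  have hsum : ∑ k ∈ shapes (D + 1) t, (excess t (generators ⟨0, hd⟩ x) k +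
      if ∑ i, k i = t then 1 else 0) ≤ 2 * ((r + 1) * (t + 1) ^ D) + (t + 1 : ℝ) ^ D := by
    rw [Finset.sum_add_distrib, ← Finset.sum_filter, Finset.sum_const, nsmul_eq_mul, mul_one]
    exact add_le_add hx (by exact_mod_cast card_shapes_sum_eq_le D t t)
  have hdisc := starDisc_ratNet_le hq _ fun a ha => (abs_boxDisc_le_sum hq _ ha).trans
    (mul_le_mul_of_nonneg_left hsum (by positivity))
  exact hdisc.trans_lt (div_lt_div_of_pos_right (final_estimate hq.two_le ht hr)
    (pow_pos (Nat.cast_pos.mpr hq.pos) _))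
end
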